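/- arXiv:2207.08682 — 4 statements merged into one kernel-verified Lean document; each statement's English description precedes it below -/
import Mathlib

section
/- Let k be odd and r an integer such that r divides k and k divides r². Then every sequence S over ℤ/kℤ of length k + r contains a subsequence S' of length at least 2 with e₂(S') ≡ 0 (mod k). That is, the second-degree Davenport constant D^{(2)}(ℤ_k) is at most k + r. -/
open Finset

/-- The `m`-th elementary symmetric expression of the subsequence of `g` selected
by the index set `J`. -/
def eSym {n : ℕ} {R : Type*} [CommRing R] (m : ℕ) (g : Fin n → R) (J : Finset (Fin n)) : R :=
  ∑ T ∈ J.powersetCard m, ∏ i ∈ T, g i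

/-- Davenport constant of `(ZMod p)^d`, via Chevalley-Warning. -/
theorem davenport_prime {ι : Type} (p : ℕ) [Fact p.Prime] (d : ℕ) (a : Fin d → ι → ZMod p)
    (s : Finset ι) (hs : d * (p - 1) < s.card) :
    ∃ t ⊆ s, t.Nonempty ∧ ∀ j, ∑ i ∈ t, a j i = 0 := by
  classical
  let F : Fin d → MvPolynomial s (ZMod p) := fun j =>
    ∑ i : s, a j i • MvPolynomial.X i ^ (p - 1)
  have hdeg : (∑ j, (F j).totalDegree) < Fintype.card s := by
    calc (∑ j, (F j).totalDegree) ≤ ∑ j : Fin d, (p - 1) := by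
          gcongr with j
          apply MvPolynomial.totalDegree_finsetSum_le
          intro i _
          exact (MvPolynomial.totalDegree_smul_le ..).trans (MvPolynomial.totalDegree_X_pow ..).le
      _ < Fintype.card s := by simpa using hs
  have hpN := char_dvd_card_solutions_of_fintype_sum_lt p hdeg
  let zero_sol : {x : s → ZMod p // ∀ j, MvPolynomial.eval x (F j) = 0} :=
    ⟨0, by simp [F, map_sum, (Fact.out : p.Prime).one_lt, tsub_eq_zero_iff_le]⟩
  have hN₀ := @Fintype.card_pos _ _ ⟨zero_sol⟩
  obtain ⟨x, hx⟩ := Fintype.exists_ne_of_one_lt_card (by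
    refine (Fact.out : p.Prime).one_lt.trans_le (Nat.le_of_dvd hN₀ ?_)
    convert hpN) zero_sol
  refine ⟨({i | x.1 i ≠ 0} : Finset _).map ⟨(↑), Subtype.val_injective⟩, ?_, ?_, ?_⟩
  · simp +contextual [subset_iff]
  · rw [Finset.map_nonempty]
    rw [← Subtype.coe_ne_coe, Function.ne_iff] at hx
    exact hx.imp (fun a ha ↦ mem_filter.2 ⟨Finset.mem_attach _ _, ha⟩)
  · intro j
    simpa [F, ZMod.pow_card_sub_one, Finset.sum_filter] using x.2 j

theorem davenport_two {ι : Type} (p : ℕ) (hp : p.Prime) (a b : ι → ℤ)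
    (s : Finset ι) (hs : 2 * p - 1 ≤ s.card) :
    ∃ t ⊆ s, t.Nonempty ∧ (p : ℤ) ∣ ∑ i ∈ t, a i ∧ (p : ℤ) ∣ ∑ i ∈ t, b i := by
  have := Fact.mk hp
  have h2 := hp.two_le
  obtain ⟨t, ht, hne, h⟩ := davenport_prime p 2
    ![fun i => (a i : ZMod p), fun i => (b i : ZMod p)] s (by omega)
  refine ⟨t, ht, hne, ?_, ?_⟩
  · rw [← ZMod.intCast_zmod_eq_zero_iff_dvd]; simpa using h 0
  · rw [← ZMod.intCast_zmod_eq_zero_iff_dvd]; simpa using h 1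

theorem eta_two {ι : Type} (p : ℕ) (hp : p.Prime) (a b : ι → ℤ)
    (s : Finset ι) (hs : 3 * p - 2 ≤ s.card) :
    ∃ t ⊆ s, t.Nonempty ∧ t.card ≤ p ∧ (p : ℤ) ∣ ∑ i ∈ t, a i ∧ (p : ℤ) ∣ ∑ i ∈ t, b i := by
  classical
  have := Fact.mk hp
  have h2 := hp.two_le
  obtain ⟨s', hs's, hs'⟩ := exists_subset_card_eq hs
  obtain ⟨t, ht, hne, h⟩ := davenport_prime p 3
    ![fun i => (a i : ZMod p), fun i => (b i : ZMod p), fun _ => 1] s' (by omega)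
  have hA : (p : ℤ) ∣ ∑ i ∈ t, a i := by
    rw [← ZMod.intCast_zmod_eq_zero_iff_dvd]; simpa using h 0
  have hB : (p : ℤ) ∣ ∑ i ∈ t, b i := by
    rw [← ZMod.intCast_zmod_eq_zero_iff_dvd]; simpa using h 1
  have hC : p ∣ t.card := by
    rw [← CharP.cast_eq_zero_iff (ZMod p)]; simpa using h 2
  have hle := card_le_card ht
  obtain ⟨c, hc⟩ := hC
  by_cases hc1 : t.card ≤ p
  · exact ⟨t, ht.trans hs's, hne, hc1, hA, hB⟩
  have hc2 : c = 2 := by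
    have : c < 3 := by
      by_contra! h3
      have := Nat.mul_le_mul_left p h3
      omega
    have : 1 < c := by by_contra! h3; nlinarith
    omega
  subst hc2
  obtain ⟨e, he⟩ := hne
  obtain ⟨u, hu, hune, huA, huB⟩ := davenport_two p hp a b (t.erase e)
    (by rw [card_erase_of_mem he]; omega)
  have hut : u ⊆ t := hu.trans (erase_subset _ _)
  by_cases hup : u.card ≤ p
  · exact ⟨u, hut.trans (ht.trans hs's), hune, hup, huA, huB⟩
  · refine ⟨t \ u, sdiff_subset.trans (ht.trans hs's), ⟨e, ?_⟩, ?_, ?_, ?_⟩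
    · rw [mem_sdiff]; exact ⟨he, fun h => by simpa using hu h⟩
    · rw [card_sdiff_of_subset hut]; omega
    · have := sum_sdiff (f := a) hut
      rw [← this] at hA
      exact (dvd_add_left huA).1 hA
    · have := sum_sdiff (f := b) hut
      rw [← this] at hB
      exact (dvd_add_left huB).1 hB

theorem extract {ι : Type} [DecidableEq ι] (p : ℕ) (hp : p.Prime) (a b : ι → ℤ) (m : ℕ) :
    ∀ s : Finset ι, p * m + 2 * p - 1 ≤ s.card →
    ∃ F : Finset (Finset ι), F.card = m + 1 ∧ (F : Set (Finset ι)).PairwiseDisjoint id ∧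
      ∀ t ∈ F, t ⊆ s ∧ t.Nonempty ∧ (p : ℤ) ∣ ∑ i ∈ t, a i ∧ (p : ℤ) ∣ ∑ i ∈ t, b i := by
  have h2 := hp.two_le
  induction m with
  | zero =>
    intro s hs
    obtain ⟨t, ht⟩ := davenport_two p hp a b s (by simpa using hs)
    exact ⟨{t}, by simp, by simp, by simpa using ht⟩
  | succ m ih =>
    intro s hs
    rw [mul_add] at hs
    obtain ⟨t, hts, hne, hcard, hA, hB⟩ := eta_two p hp a b s (by omega)
    obtain ⟨F, hF, hd, hp⟩ := ih (s \ t) (by rw [card_sdiff_of_subset hts]; omega)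
    have hdis : ∀ u ∈ F, Disjoint t u := fun u hu =>
      (disjoint_of_subset_left (hp u hu).1 sdiff_disjoint).symm
    have htF : t ∉ F := fun h => hne.ne_empty (disjoint_self_iff_empty _ |>.1 (hdis t h))
    refine ⟨insert t F, by rw [card_insert_of_notMem htF, hF], ?_, ?_⟩
    · rw [coe_insert]
      exact hd.insert fun u hu _ => hdis u hu
    · intro u hu
      rcases mem_insert.1 hu with rfl | hu
      · exact ⟨hts, hne, hA, hB⟩
      · exact ⟨(hp u hu).1.trans sdiff_subset, (hp u hu).2⟩

theorem davenport_cyclic {ι : Type} (k : ℕ) (hk : 0 < k) (b : ι → ℤ)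
    (s : Finset ι) (hs : k ≤ s.card) : ∃ t ⊆ s, t.Nonempty ∧ (k : ℤ) ∣ ∑ i ∈ t, b i := by
  classical
  obtain ⟨t, ht, hc, hd⟩ := Int.erdos_ginzburg_ziv (n := k)
    (s := s.disjSum (univ : Finset (Fin (k - 1)))) (Sum.elim b 0)
    (by rw [card_disjSum, card_fin]; omega)
  refine ⟨t.toLeft, ?_, ?_, ?_⟩
  · intro i hi
    simpa using ht (mem_toLeft.1 hi)
  · rw [← card_pos]
    have h1 := card_toLeft_add_card_toRight (u := t)
    have h2 := card_le_univ t.toRight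
    rw [Fintype.card_fin] at h2
    omega
  · rw [← toLeft_disjSum_toRight (u := t), sum_disjSum] at hd
    simpa using hd

theorem olson (r : ℕ) : ∀ (k : ℕ), 0 < k → r ∣ k → ∀ (ι : Type) (a b : ι → ℤ)
    (s : Finset ι), r + k - 1 ≤ s.card →
    ∃ t ⊆ s, t.Nonempty ∧ (r : ℤ) ∣ ∑ i ∈ t, a i ∧ (k : ℤ) ∣ ∑ i ∈ t, b i := by
  classical
  induction r using Nat.strong_induction_on with
  | _ r ih =>
  intro k hk hrk ι a b s hs
  have hr : 0 < r := Nat.pos_of_dvd_of_pos hrk hk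
  by_cases hr1 : r = 1
  · subst hr1
    obtain ⟨t, h1, h2, h3⟩ := davenport_cyclic k hk b s (by omega)
    exact ⟨t, h1, h2, by simp, h3⟩
  obtain ⟨p, hp, r', rfl⟩ := Nat.exists_prime_and_dvd hr1
  obtain ⟨c, rfl⟩ := hrk
  have hr' : 0 < r' := Nat.pos_of_mul_pos_left hr
  have hk' : 0 < r' * c := by
    rw [mul_assoc] at hk; exact Nat.pos_of_mul_pos_left hk
  rw [mul_assoc] at hs ⊢
  generalize hkk : r' * c = k' at *
  obtain ⟨F, hF, hd, hFp⟩ := extract p hp a b (r' + k' - 2) s (by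
    have : p * (r' + k' - 2) + 2 * p = p * r' + p * k' := by
      obtain ⟨x, rfl⟩ := Nat.exists_eq_add_of_lt hr'
      obtain ⟨y, rfl⟩ := Nat.exists_eq_add_of_lt hk'
      have : 0 + x + 1 + (0 + y + 1) - 2 = x + y := by omega
      rw [this]; ring
    omega)
  have hlt : r' < p * r' := by nlinarith [hp.two_le]
  obtain ⟨T, hT, hTne, hA, hB⟩ := ih r' hlt k' hk' ⟨c, hkk.symm⟩ (Finset ι)
    (fun t => (∑ i ∈ t, a i) / p) (fun t => (∑ i ∈ t, b i) / p) F (by omega)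
  have hdT : (T : Set (Finset ι)).PairwiseDisjoint id := hd.subset (by exact_mod_cast hT)
  have key : ∀ f : ι → ℤ, (∀ t ∈ F, (p : ℤ) ∣ ∑ i ∈ t, f i) →
      ∑ i ∈ T.biUnion id, f i = p * ∑ t ∈ T, (∑ i ∈ t, f i) / p := by
    intro f hf
    rw [sum_biUnion hdT, mul_sum]
    exact sum_congr rfl fun t ht => (Int.mul_ediv_cancel' (hf t (hT ht))).symm
  refine ⟨T.biUnion id, ?_, ?_, ?_, ?_⟩
  · exact biUnion_subset.2 fun t ht => (hFp t (hT ht)).1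
  · obtain ⟨t, ht⟩ := hTne
    obtain ⟨i, hi⟩ := (hFp t (hT ht)).2.1
    exact ⟨i, mem_biUnion.2 ⟨t, ht, hi⟩⟩
  · rw [key a fun t ht => (hFp t ht).2.2.1]
    push_cast
    exact mul_dvd_mul_left _ hA
  · rw [key b fun t ht => (hFp t ht).2.2.2]
    push_cast
    exact mul_dvd_mul_left _ hB

theorem esymm_two_sq {R : Type*} [CommRing R] (m : Multiset R) :
    m.sum ^ 2 = (m.map (· ^ 2)).sum + 2 * m.esymm 2 := by
  induction m using Multiset.induction_on with
  | empty => simp [Multiset.esymm, Multiset.powersetCard_zero_right 1]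
  | cons x m ih =>
    have : (x ::ₘ m).esymm 2 = m.esymm 2 + x * m.sum := by
      simp [Multiset.esymm, Multiset.powersetCard_cons, Multiset.powersetCard_one]
      simpa using Multiset.sum_map_mul_left (s := m) (a := x) (f := fun y => y)
    rw [this, Multiset.sum_cons, Multiset.map_cons, Multiset.sum_cons]
    linear_combination ih

theorem stmt_3 (k r : ℕ) (hk : Odd k) (hrk : r ∣ k) (hkr : k ∣ r ^ 2)
    (n : ℕ) (hn : k + r ≤ n) (g : Fin n → ZMod k) :
    ∃ J : Finset (Fin n), 2 ≤ J.card ∧ eSym 2 g J = 0 := by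
  classical
  have hk0 : 0 < k := hk.pos
  have hr0 : 0 < r := Nat.pos_of_dvd_of_pos hrk hk0
  have : NeZero k := ⟨hk0.ne'⟩
  let a : Fin n → ℤ := fun i => ((g i).val : ℤ)
  have ha : ∀ i, ((a i : ℤ) : ZMod k) = g i := fun i => by simp [a]
  have main : ∀ J : Finset (Fin n), (r : ℤ) ∣ ∑ i ∈ J, a i → (k : ℤ) ∣ ∑ i ∈ J, a i ^ 2 →
      eSym 2 g J = 0 := by
    intro J h1 h2
    have h3 : (k : ℤ) ∣ (∑ i ∈ J, a i) ^ 2 :=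
      (by exact_mod_cast hkr : (k : ℤ) ∣ (r : ℤ) ^ 2).trans (pow_dvd_pow_of_dvd h1 2)
    rw [← ZMod.intCast_zmod_eq_zero_iff_dvd] at h2 h3
    push_cast at h2 h3
    simp only [ha] at h2 h3
    have h4 := esymm_two_sq (J.val.map g)
    rw [Finset.esymm_map_val, Multiset.map_map] at h4
    change (∑ i ∈ J, g i) ^ 2 = (∑ i ∈ J, g i ^ 2) + 2 * eSym 2 g J at h4
    rw [h2, h3, zero_add] at h4
    have hu : IsUnit ((2 : ℕ) : ZMod k) :=
      (ZMod.isUnit_iff_coprime 2 k).2 (Nat.coprime_two_left.2 hk)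
    push_cast at hu
    exact (hu.mul_right_eq_zero).1 h4.symm
  obtain ⟨J, -, hJ, hA, hB⟩ := olson r k hk0 hrk (Fin n) a (fun i => a i ^ 2) univ
    (by rw [card_fin]; omega)
  by_cases hc : 2 ≤ J.card
  · exact ⟨J, hc, main J hA hB⟩
  obtain ⟨J', hs', hJ', hA', hB'⟩ := olson r k hk0 hrk (Fin n) a (fun i => a i ^ 2) (univ \ J)
    (by rw [card_sdiff_of_subset (subset_univ _), card_fin]; omega)
  have hdis : Disjoint J J' := (disjoint_of_subset_left hs' sdiff_disjoint).symm
  refine ⟨J ∪ J', ?_, main _ ?_ ?_⟩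
  · rw [card_union_of_disjoint hdis]
    have := hJ.card_pos
    have := hJ'.card_pos
    omega
  · rw [sum_union hdis]; exact dvd_add hA hA'
  · rw [sum_union hdis]; exact dvd_add hB hB'
end

section
/- Let p be prime and r, s, u positive integers with r ≥ s + u. Then EGZ_{p^r}^{(p^u)}(ℤ_{p^s}) = p^r + p^{s+u} − p^u. -/
open Finset

/-- Alternating sums over the Boolean cube kill polynomials of small degree. -/
lemma alt_sum_eq_zero {n : ℕ} (V : Finset (Fin n)) (P : MvPolynomial (Fin n) ℤ)
    (hP : P.totalDegree < V.card) :
    ∑ J ∈ V.powerset, (-1 : ℤ) ^ J.card *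
      MvPolynomial.eval (fun i => if i ∈ J then (1 : ℤ) else 0) P = 0 := by
  classical
  simp_rw [MvPolynomial.eval_eq, Finset.mul_sum]
  rw [Finset.sum_comm]
  refine Finset.sum_eq_zero fun d hd => ?_
  have hdeg : d.support.card < V.card := by
    refine lt_of_le_of_lt ?_ (lt_of_le_of_lt (MvPolynomial.le_totalDegree hd) hP)
    rw [Finsupp.sum, Finset.card_eq_sum_ones]
    refine Finset.sum_le_sum fun i hi => ?_
    exact Nat.one_le_iff_ne_zero.mpr (Finsupp.mem_support_iff.mp hi)
  obtain ⟨i, hiV, hid⟩ := Finset.exists_mem_notMem_of_card_lt_card hdeg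
  have key : ∀ J ∈ V.powerset, (-1 : ℤ) ^ J.card * (MvPolynomial.coeff d P *
      ∏ j ∈ d.support, (if j ∈ J then (1 : ℤ) else 0) ^ d j) =
      (MvPolynomial.coeff d P * ∏ j ∈ d.support \ V, (0 : ℤ)) *
      ((∏ _j ∈ J, (-1 : ℤ)) * ∏ j ∈ V \ J, (if j ∈ d.support then (0 : ℤ) else 1)) := by
    intro J hJ
    rw [Finset.mem_powerset] at hJ
    have h1 : ∏ j ∈ d.support, (if j ∈ J then (1 : ℤ) else 0) ^ d j =
        (∏ j ∈ d.support \ V, (0 : ℤ)) *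
        ∏ j ∈ V \ J, (if j ∈ d.support then (0 : ℤ) else 1) := by
      by_cases h : d.support ⊆ J
      · rw [Finset.prod_eq_one, Finset.sdiff_eq_empty_iff_subset.mpr (h.trans hJ),
          Finset.prod_empty, Finset.prod_eq_one, one_mul]
        · intro j hj
          rw [Finset.mem_sdiff] at hj
          rw [if_neg fun h' => hj.2 (h h')]
        · intro j hj
          rw [if_pos (h hj), one_pow]
      · obtain ⟨j, hj, hjJ⟩ := Finset.not_subset.mp h
        rw [Finset.prod_eq_zero hj]
        · by_cases hjV : j ∈ V
          · rw [Finset.prod_eq_zero (s := V \ J) (i := j), mul_zero]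
            · simp [hjV, hjJ]
            · rw [if_pos hj]
          · rw [Finset.prod_eq_zero (s := d.support \ V) (i := j), zero_mul]
            · rw [Finset.mem_sdiff]; exact ⟨hj, hjV⟩
            · rfl
        · rw [if_neg hjJ, zero_pow (Finsupp.mem_support_iff.mp hj)]
    rw [h1, Finset.prod_const (s := J)]
    ring
  rw [Finset.sum_congr rfl key, ← Finset.mul_sum, ← Finset.prod_add]
  rw [Finset.prod_eq_zero hiV, mul_zero]
  rw [if_neg hid]
  norm_num

lemma dvd_of_not_dvd_choose {p s x : ℕ} (hp : p.Prime)
    (h : ¬ p ∣ (x + (p ^ s - 1)).choose (p ^ s - 1)) : p ^ s ∣ x := by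
  have h1 := Nat.choose_succ_right_eq (x + (p ^ s - 1)) (p ^ s - 1)
  have hpos : 0 < p ^ s := pow_pos hp.pos s
  rw [Nat.sub_add_cancel hpos, Nat.add_sub_cancel] at h1
  have h2 : p ^ s ∣ (x + (p ^ s - 1)).choose (p ^ s - 1) * x := ⟨_, by rw [← h1, mul_comm]⟩
  exact (Nat.Coprime.pow_left s ((Nat.Prime.coprime_iff_not_dvd hp).mpr h)).dvd_of_dvd_mul_left h2

lemma totalDegree_prod_shift {n : ℕ} (Q : MvPolynomial (Fin n) ℤ) (m k : ℕ)
    (hQ : Q.totalDegree ≤ m) :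
    (∏ j ∈ range k, (Q + MvPolynomial.C ((j : ℤ) + 1))).totalDegree ≤ m * k := by
  refine (MvPolynomial.totalDegree_finsetProd _ _).trans ?_
  refine (Finset.sum_le_card_nsmul _ _ m fun j _ => ?_).trans (by simp [mul_comm])
  refine (MvPolynomial.totalDegree_add _ _).trans ?_
  rw [MvPolynomial.totalDegree_C]
  simp [hQ]

lemma prod_shift_eq (x k : ℕ) :
    ∏ j ∈ range k, ((x : ℤ) + ((j : ℤ) + 1)) = (k.factorial : ℤ) * ((x + k).choose k : ℤ) := by
  have h := Nat.ascFactorial_eq_factorial_mul_choose x k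
  rw [Nat.ascFactorial_eq_prod_range] at h
  rw [← Nat.cast_mul, ← h]
  push_cast
  exact Finset.prod_congr rfl fun j _ => by ring

lemma upper_aux {n : ℕ} (p : ℕ) (hp : p.Prime) (r s u : ℕ) (V : Finset (Fin n))
    (hV : p ^ r - 1 + p ^ u * (p ^ s - 1) < V.card) (a : Fin n → ℕ) :
    ∃ J ⊆ V, J ≠ ∅ ∧ p ^ r ∣ J.card ∧
      p ^ s ∣ ∑ T ∈ J.powersetCard (p ^ u), ∏ i ∈ T, a i := by
  classical
  set E : Finset (Fin n) → ℕ := fun J => ∑ T ∈ J.powersetCard (p ^ u), ∏ i ∈ T, a i with hE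
  let Q1 : MvPolynomial (Fin n) ℤ := ∑ i ∈ V, MvPolynomial.X i
  let Q2 : MvPolynomial (Fin n) ℤ :=
    ∑ T ∈ V.powersetCard (p ^ u), ∏ i ∈ T, (MvPolynomial.C (a i : ℤ) * MvPolynomial.X i)
  have hQ1 : Q1.totalDegree ≤ 1 := by
    refine MvPolynomial.totalDegree_finsetSum_le fun i _ => ?_
    simp
  have hQ2 : Q2.totalDegree ≤ p ^ u := by
    refine MvPolynomial.totalDegree_finsetSum_le fun T hT => ?_
    refine (MvPolynomial.totalDegree_finsetProd _ _).trans ?_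
    refine (Finset.sum_le_card_nsmul _ _ 1 fun j _ => ?_).trans
      (by simp [(Finset.mem_powersetCard.mp hT).2])
    refine (MvPolynomial.totalDegree_mul _ _).trans ?_
    rw [MvPolynomial.totalDegree_C]
    simp
  let ev : Finset (Fin n) → Fin n → ℤ := fun J i => if i ∈ J then (1 : ℤ) else 0
  have e1 : ∀ J ⊆ V, MvPolynomial.eval (ev J) Q1 = (J.card : ℤ) := by
    intro J hJ
    simp only [Q1, ev, map_sum, MvPolynomial.eval_X, Finset.sum_ite_mem,
      Finset.inter_eq_right.mpr hJ]
    simp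
  have e2 : ∀ J ⊆ V, MvPolynomial.eval (ev J) Q2 = (E J : ℤ) := by
    intro J hJ
    simp only [Q2, ev, map_sum, map_prod, map_mul, MvPolynomial.eval_X, MvPolynomial.eval_C, hE]
    push_cast
    symm
    rw [← Finset.sum_subset (Finset.powersetCard_mono hJ)]
    · refine Finset.sum_congr rfl fun T hT => Finset.prod_congr rfl fun i hi => ?_
      rw [if_pos ((Finset.mem_powersetCard.mp hT).1 hi), mul_one]
    · intro T hT hTJ
      rw [Finset.mem_powersetCard] at hT hTJ
      have : ¬ T ⊆ J := fun h => hTJ ⟨h, hT.2⟩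
      obtain ⟨i, hi, hiJ⟩ := Finset.not_subset.mp this
      refine Finset.prod_eq_zero hi ?_
      rw [if_neg hiJ, mul_zero]
  let P : MvPolynomial (Fin n) ℤ :=
    (∏ j ∈ range (p ^ r - 1), (Q1 + MvPolynomial.C ((j : ℤ) + 1))) *
    (∏ j ∈ range (p ^ s - 1), (Q2 + MvPolynomial.C ((j : ℤ) + 1)))
  have hP : P.totalDegree < V.card := by
    refine lt_of_le_of_lt ((MvPolynomial.totalDegree_mul _ _).trans ?_) hV
    have := totalDegree_prod_shift Q1 1 (p ^ r - 1) hQ1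
    have := totalDegree_prod_shift Q2 (p ^ u) (p ^ s - 1) hQ2
    omega
  have eP : ∀ J ∈ V.powerset, (-1 : ℤ) ^ J.card * MvPolynomial.eval (ev J) P =
      (((p ^ r - 1).factorial : ℤ) * ((p ^ s - 1).factorial : ℤ)) * ((-1 : ℤ) ^ J.card *
      ((((J.card + (p ^ r - 1)).choose (p ^ r - 1) : ℕ) : ℤ) *
      (((E J + (p ^ s - 1)).choose (p ^ s - 1) : ℕ) : ℤ))) := by
    intro J hJ
    rw [Finset.mem_powerset] at hJ
    simp only [P, map_mul, map_prod, map_add, MvPolynomial.eval_C, e1 J hJ, e2 J hJ]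
    rw [prod_shift_eq, prod_shift_eq]
    ring
  have h0 := alt_sum_eq_zero V P hP
  rw [Finset.sum_congr rfl eP, ← Finset.mul_sum] at h0
  have hne : (((p ^ r - 1).factorial : ℤ) * ((p ^ s - 1).factorial : ℤ)) ≠ 0 := by positivity
  have h1 := (mul_eq_zero.mp h0).resolve_left hne
  by_contra hcon
  push Not at hcon
  rw [← Finset.add_sum_erase _ _ (Finset.empty_mem_powerset V)] at h1
  have hE0 : E ∅ = 0 := by
    simp only [hE]
    rw [Finset.powersetCard_eq_empty.mpr (by simpa using pow_pos hp.pos u), Finset.sum_empty]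
  have hdvd : (p : ℤ) ∣ ∑ J ∈ V.powerset.erase ∅, ((-1 : ℤ) ^ J.card *
      ((((J.card + (p ^ r - 1)).choose (p ^ r - 1) : ℕ) : ℤ) *
      (((E J + (p ^ s - 1)).choose (p ^ s - 1) : ℕ) : ℤ))) := by
    refine Finset.dvd_sum fun J hJ => ?_
    rw [Finset.mem_erase, Finset.mem_powerset] at hJ
    refine Dvd.dvd.mul_left ?_ _
    by_cases hc : p ∣ (J.card + (p ^ r - 1)).choose (p ^ r - 1)
    · exact Dvd.dvd.mul_right (Int.natCast_dvd_natCast.mpr hc) _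
    · refine Dvd.dvd.mul_left (Int.natCast_dvd_natCast.mpr ?_) _
      by_contra hc2
      exact hcon J hJ.2 (Finset.nonempty_iff_ne_empty.mpr hJ.1) (dvd_of_not_dvd_choose hp hc) (dvd_of_not_dvd_choose hp hc2)
  rw [hE0] at h1
  simp only [Finset.card_empty, zero_add, Nat.choose_self, pow_zero, Nat.cast_one, mul_one] at h1
  have : (p : ℤ) ∣ 1 := by
    have h2 : (1 : ℤ) = - ∑ J ∈ V.powerset.erase ∅, ((-1 : ℤ) ^ J.card *
      ((((J.card + (p ^ r - 1)).choose (p ^ r - 1) : ℕ) : ℤ) *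
      (((E J + (p ^ s - 1)).choose (p ^ s - 1) : ℕ) : ℤ))) := by linarith
    rw [h2]
    exact (dvd_neg).mpr hdvd
  have h3 : p ∣ 1 := by exact_mod_cast this
  exact hp.one_lt.ne' (Nat.dvd_one.mp h3)

lemma not_dvd_choose {p s u k : ℕ} (hp : p.Prime) (hs : 1 ≤ s) (h1 : p ^ u ≤ k)
    (h2 : k < p ^ (s + u)) : ¬ p ^ s ∣ k.choose (p ^ u) := by
  intro h
  have hlog : Nat.log p k < s + u := Nat.log_lt_of_lt_pow (by have := pow_pos hp.pos u; omega) h2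
  have hm := hp.emultiplicity_choose h1 hlog
  have hle : (s : ℕ∞) ≤ emultiplicity p (k.choose (p ^ u)) := le_emultiplicity_of_pow_dvd h
  rw [hm] at hle
  have hle' : s ≤ #{i ∈ Ico 1 (s + u) | p ^ i ≤ p ^ u % p ^ i + (k - p ^ u) % p ^ i} := by
    exact_mod_cast hle
  have hsub : {i ∈ Ico 1 (s + u) | p ^ i ≤ p ^ u % p ^ i + (k - p ^ u) % p ^ i} ⊆
      Ico (u + 1) (s + u) := by
    intro i hi
    rw [Finset.mem_filter, Finset.mem_Ico] at hi
    rw [Finset.mem_Ico]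
    refine ⟨?_, hi.1.2⟩
    by_contra hc
    have h3 : p ^ u % p ^ i = 0 := Nat.mod_eq_zero_of_dvd (pow_dvd_pow p (by omega))
    have h4 := Nat.mod_lt (k - p ^ u) (pow_pos hp.pos i)
    omega
  have := Finset.card_le_card hsub
  rw [Nat.card_Ico] at this
  omega

theorem stmt_12 (p : ℕ) (hp : p.Prime) (r s u : ℕ) (hs : 1 ≤ s) (hu : 1 ≤ u)
    (hr : s + u ≤ r) :
    IsLeast {z : ℕ | ∀ n : ℕ, z ≤ n → ∀ g : Fin n → ZMod (p ^ s),
        ∃ J : Finset (Fin n), J.card = p ^ r ∧ eSym (p ^ u) g J = 0}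
      (p ^ r + p ^ (s + u) - p ^ u) := by
  classical
  have hpu : 0 < p ^ u := pow_pos hp.pos u
  have hpr : p ^ (s + u) ≤ p ^ r := Nat.pow_le_pow_right hp.pos hr
  have hps : p ^ u < p ^ (s + u) := Nat.pow_lt_pow_right hp.one_lt (by omega)
  have : NeZero (p ^ s) := ⟨(pow_pos hp.pos s).ne'⟩
  constructor
  · intro n hn g
    obtain ⟨V, -, hV⟩ := Finset.exists_subset_card_eq
      (s := (Finset.univ : Finset (Fin n))) (n := p ^ r + p ^ (s + u) - p ^ u) (by simpa using hn)
    have hmul : p ^ u * (p ^ s - 1) = p ^ (s + u) - p ^ u := by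
      rw [Nat.mul_sub, mul_one, pow_add, mul_comm]
    obtain ⟨J, hJV, hJ, hJr, hJs⟩ := upper_aux p hp r s u V (by rw [hmul, hV]; omega)
      (fun i => (g i).val)
    refine ⟨J, ?_, ?_⟩
    · obtain ⟨c, hc⟩ := hJr
      have hle := Finset.card_le_card hJV
      have hpos : 0 < J.card := Finset.card_pos.mpr (Finset.nonempty_iff_ne_empty.mpr hJ)
      have hc0 : c ≠ 0 := by rintro rfl; omega
      have hc2 : c < 2 := by
        by_contra h
        have : p ^ r * 2 ≤ p ^ r * c := Nat.mul_le_mul_left _ (by omega)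
        omega
      have : c = 1 := by omega
      rw [hc, this, mul_one]
    · rw [← ZMod.natCast_eq_zero_iff] at hJs
      rw [← hJs, eSym]
      push_cast
      refine Finset.sum_congr rfl fun T _ => Finset.prod_congr rfl fun i _ => ?_
      rw [ZMod.natCast_zmod_val]
  · intro z hz
    by_contra hlt
    push Not at hlt
    obtain ⟨J, hJ, hJ0⟩ := hz (p ^ r + p ^ (s + u) - p ^ u - 1) (by omega)
      (fun i => if i.val < p ^ (s + u) - 1 then 1 else 0)
    set K := J.filter (fun i => i.val < p ^ (s + u) - 1) with hK
    have hsum : eSym (p ^ u) (fun i : Fin (p ^ r + p ^ (s + u) - p ^ u - 1) =>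
        if i.val < p ^ (s + u) - 1 then (1 : ZMod (p ^ s)) else 0) J
        = ((K.card.choose (p ^ u) : ℕ) : ZMod (p ^ s)) := by
      rw [eSym, ← Finset.card_powersetCard, Finset.card_eq_sum_ones]
      push_cast
      symm
      rw [← Finset.sum_subset (Finset.powersetCard_mono (hK ▸ Finset.filter_subset _ J : K ⊆ J))]
      · refine Finset.sum_congr rfl fun T hT => (Finset.prod_eq_one fun i hi => ?_).symm
        have := (Finset.mem_powersetCard.mp hT).1 hi
        rw [Finset.mem_filter] at this
        rw [if_pos this.2]
      · intro T hT hTK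
        rw [Finset.mem_powersetCard] at hT hTK
        have : ¬ T ⊆ K := fun h => hTK ⟨h, hT.2⟩
        obtain ⟨i, hi, hiK⟩ := Finset.not_subset.mp this
        refine Finset.prod_eq_zero hi ?_
        rw [if_neg]
        intro h
        exact hiK (Finset.mem_filter.mpr ⟨hT.1 hi, h⟩)
    rw [hsum, ZMod.natCast_eq_zero_iff] at hJ0
    have hKle : K.card ≤ p ^ (s + u) - 1 := by
      have := Finset.card_le_card_of_injOn (s := K) (t := range (p ^ (s + u) - 1))
        (fun i => i.val) (fun i hi => by
          have hi' := (Finset.mem_filter.mp (Finset.mem_coe.mp hi)).2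
          simpa using hi') (fun i _ j _ h => Fin.ext h)
      simpa using this
    have hKc : (J.filter (fun i => ¬ i.val < p ^ (s + u) - 1)).card ≤ p ^ r - p ^ u := by
      have := Finset.card_le_card_of_injOn
        (s := J.filter (fun i => ¬ i.val < p ^ (s + u) - 1))
        (t := Ico (p ^ (s + u) - 1) (p ^ r + p ^ (s + u) - p ^ u - 1))
        (fun i => i.val) (fun i hi => by
          have hi' := (Finset.mem_filter.mp (Finset.mem_coe.mp hi)).2
          have := i.isLt
          simp only [Finset.coe_Ico, Set.mem_Ico]
          omega) (fun i _ j _ h => Fin.ext h)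
      rw [Nat.card_Ico] at this
      omega
    have hadd := Finset.card_filter_add_card_filter_not (s := J)
      (fun i => i.val < p ^ (s + u) - 1)
    rw [← hK, hJ] at hadd
    exact not_dvd_choose hp hs (by omega) (by omega) hJ0
end

section
/- Let k be odd, ℓ ≥ 1, and r an integer with r | k and k | r². Then every sequence over ℤ/kℤ of length (ℓ+1)k + 2r − 3 contains a subsequence S' of length ℓk with e₂(S') ≡ 0 (mod k). In particular, if k = r², then EGZ_k^{(2)}(ℤ_k) ≤ 2r² + 2r − 3. -/
open Finset

/-- Finite-difference polynomials of degree less than `n`. -/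
def FDPoly {V F : Type} [AddCommGroup V] [CommRing F] : ℕ → (V → F) → Prop
  | 0, h => ∀ x, h x = 0
  | n + 1, h => ∀ v, FDPoly n (fun x => h x - h (x + v))

section FD
variable {V F : Type} [AddCommGroup V] [CommRing F]

theorem FDPoly.alt {ι : Type} [DecidableEq ι] (f : ι → V) (J : Finset ι) :
    ∀ (h : V → F), FDPoly J.card h → ∀ x,
      ∑ T ∈ J.powerset, (-1) ^ T.card * h (x + ∑ i ∈ T, f i) = 0 := by
  induction J using Finset.induction_on with
  | empty => intro h hh x; simpa using hh x
  | insert a J ha ih =>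
    intro h hh x
    rw [card_insert_of_notMem ha] at hh
    have := ih _ (hh (f a)) x
    rw [sum_powerset_insert ha, ← sum_add_distrib, ← this]
    refine sum_congr rfl fun T hT => ?_
    have haT : a ∉ T := fun h => ha (mem_powerset.1 hT h)
    rw [card_insert_of_notMem haT, sum_insert haT, add_comm (f a), add_assoc]
    ring

theorem FDPoly.shift {n : ℕ} : ∀ {h : V → F}, FDPoly n h → ∀ u, FDPoly n (fun x => h (x + u)) := by
  induction n with
  | zero => intro h hh u x; exact hh _
  | succ n ih =>
    intro h hh u v
    have := ih (hh v) u
    simpa [add_right_comm] using this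

theorem FDPoly.add {n : ℕ} : ∀ {h k : V → F}, FDPoly n h → FDPoly n k →
    FDPoly n (fun x => h x + k x) := by
  induction n with
  | zero => intro h k hh hk x; simp [hh x, hk x]
  | succ n ih =>
    intro h k hh hk v
    have := ih (hh v) (hk v)
    convert this using 2
    ring

theorem FDPoly.zero {n : ℕ} : FDPoly n (fun _ : V => (0 : F)) := by
  induction n with
  | zero => intro x; rfl
  | succ n ih => intro v; simpa using ih

theorem FDPoly.succ {n : ℕ} : ∀ {h : V → F}, FDPoly n h → FDPoly (n + 1) h := by
  induction n with
  | zero => 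
    intro h hh v x
    simp [hh _]
  | succ n ih => intro h hh v; exact ih (hh v)

theorem FDPoly.mono {n m : ℕ} (hnm : n ≤ m) {h : V → F} (hh : FDPoly n h) : FDPoly m h := by
  induction hnm with
  | refl => exact hh
  | step _ ih => exact ih.succ

theorem FDPoly.const (c : F) : FDPoly 1 (fun _ : V => c) := by
  intro v x; simp

theorem FDPoly.mul' (s : ℕ) : ∀ (a b : ℕ), a + b = s → ∀ {h k : V → F}, FDPoly (a + 1) h →
    FDPoly (b + 1) k → FDPoly (s + 1) (fun x => h x * k x) := by
  induction s with
  | zero =>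
    intro a b hab h k hh hk v x
    obtain ⟨rfl, rfl⟩ : a = 0 ∧ b = 0 := by omega
    have h1 : h x - h (x + v) = 0 := hh v x
    have h2 : k x - k (x + v) = 0 := hk v x
    show h x * k x - h (x + v) * k (x + v) = 0
    linear_combination k x * h1 + h (x + v) * h2
  | succ s ih =>
    intro a b hab h k hh hk v
    have e : (fun x => h x * k x - h (x + v) * k (x + v)) =
      fun x => (h x - h (x + v)) * k x + h (x + v) * (k x - k (x + v)) := by
      funext x; ring
    rw [e]
    apply FDPoly.add (h := fun x => (h x - h (x + v)) * k x)
      (k := fun x => h (x + v) * (k x - k (x + v)))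
    · rcases a with _ | a
      · have : ∀ x, h x - h (x + v) = 0 := hh v
        simp only [this, zero_mul]
        exact FDPoly.zero
      · exact ih a b (by omega) (hh v) hk
    · rcases b with _ | b
      · have : ∀ x, k x - k (x + v) = 0 := hk v
        simp only [this, mul_zero]
        exact FDPoly.zero
      · exact ih a b (by omega) (hh.shift v) (hk v)

theorem FDPoly.mul {a b : ℕ} {h k : V → F} (hh : FDPoly (a + 1) h)
    (hk : FDPoly (b + 1) k) : FDPoly (a + b + 1) (fun x => h x * k x) :=
  FDPoly.mul' _ a b rfl hh hk

theorem FDPoly.linear (l : V →+ F) : FDPoly 2 (fun x => l x) := by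
  intro v w x; simp

theorem FDPoly.pow (l : V →+ F) (n : ℕ) : FDPoly (n + 1) (fun x => l x ^ n) := by
  induction n with
  | zero => simpa using FDPoly.const 1
  | succ n ih =>
    simp only [pow_succ]
    exact ih.mul (b := 1) (FDPoly.linear l)

theorem FDPoly.one_sub (l : V →+ F) (n : ℕ) : FDPoly (n + 1) (fun x => 1 - l x ^ n) := by
  have h1 : FDPoly (n+1) (fun _ : V => (1:F)) := (FDPoly.const 1).mono (by omega)
  have h2 : FDPoly (n+1) (fun x => (-1) * l x ^ n) := by
    simpa using (FDPoly.const (-1)).mul (a := 0) (FDPoly.pow l n)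
  simpa [sub_eq_add_neg] using h1.add h2

end FD

/-- The indicator function of the origin. -/
def ind0 (p : ℕ) : (ZMod p × ZMod p) × ZMod p → ZMod p := fun x => if x = 0 then 1 else 0

theorem ind0_poly (p : ℕ) [Fact p.Prime] :
    FDPoly ((p - 1) + (p - 1) + (p - 1) + 1) (ind0 p) := by
  have h := ((FDPoly.one_sub (V := (ZMod p × ZMod p) × ZMod p)
    ((AddMonoidHom.fst _ _).comp (AddMonoidHom.fst _ _)) (p - 1)).mul 
    (FDPoly.one_sub ((AddMonoidHom.snd _ _).comp (AddMonoidHom.fst _ _)) (p - 1))).mul 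
    (FDPoly.one_sub (AddMonoidHom.snd _ _) (p - 1))
  convert h using 1
  funext ⟨⟨x, y⟩, z⟩
  have key : ∀ x : ZMod p, 1 - x ^ (p - 1) = if x = 0 then 1 else 0 := by
    intro x
    split_ifs with hx
    · have := (Fact.out : p.Prime).two_le
      rw [hx, zero_pow (by omega)]; simp
    · rw [ZMod.pow_card_sub_one_eq_one hx]; simp
  simp [ind0, key, Prod.ext_iff]
  split_ifs <;> simp_all

/-- Subsets of `J` of size `s` and `f`-sum `v`. -/
def ZS {ι V : Type} [AddCommGroup V] [DecidableEq V] (f : ι → V) (J : Finset ι) (s : ℕ) (v : V) :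
    Finset (Finset ι) := (J.powersetCard s).filter fun T => ∑ i ∈ T, f i = v

section ZSlemmas
variable {ι V : Type} [AddCommGroup V] [DecidableEq V] [DecidableEq ι] (f : ι → V)

theorem mem_ZS {J : Finset ι} {s : ℕ} {v : V} {T : Finset ι} :
    T ∈ ZS f J s v ↔ (T ⊆ J ∧ T.card = s) ∧ ∑ i ∈ T, f i = v := by
  simp [ZS]

theorem ZS_compl (J : Finset ι) (s t : ℕ) (hst : s + t = J.card) (u v : V)
    (huv : u + v = ∑ i ∈ J, f i) : (ZS f J s u).card = (ZS f J t v).card := by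
  have aux : ∀ (s t : ℕ) (hst : s + t = J.card) (u v : V)
    (huv : u + v = ∑ i ∈ J, f i), ∀ T ∈ ZS f J s u, J \ T ∈ ZS f J t v := by
    intro s t hst u v huv T hT
    rw [mem_ZS] at hT ⊢
    obtain ⟨⟨h1, h2⟩, h3⟩ := hT
    refine ⟨⟨sdiff_subset, ?_⟩, ?_⟩
    · rw [card_sdiff_of_subset h1]; omega
    · have := sum_sdiff (f := f) h1
      rw [h3, ← huv, add_comm u] at this
      exact add_right_cancel this
  refine card_bij' (fun T _ => J \ T) (fun T _ => J \ T) (aux s t hst u v huv)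
    (aux t s (by omega) v u (by rw [← huv, add_comm])) ?_ ?_
  · intro T hT; rw [mem_ZS] at hT; exact Finset.sdiff_sdiff_eq_self hT.1.1
  · intro T hT; rw [mem_ZS] at hT; exact Finset.sdiff_sdiff_eq_self hT.1.1

theorem ZS_swap (J : Finset ι) (s t : ℕ) (u v : V) :
    ∑ A ∈ ZS f J s u, (ZS f (J \ A) t v).card = ∑ C ∈ ZS f J t v, (ZS f (J \ C) s u).card := by
  simp only [card_eq_sum_ones]
  refine sum_comm' fun A C => ?_
  simp only [mem_ZS, subset_sdiff, disjoint_comm (a := C)]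
  tauto

theorem ZS_mono {J K : Finset ι} (h : J ⊆ K) (s : ℕ) (v : V) : ZS f J s v ⊆ ZS f K s v := by
  intro T; simp only [mem_ZS]
  exact fun hT => ⟨⟨hT.1.1.trans h, hT.1.2⟩, hT.2⟩

theorem ZS_large {J : Finset ι} {s : ℕ} (h : J.card < s) (v : V) : ZS f J s v = ∅ := by
  rw [ZS, powersetCard_eq_empty.2 h]; simp

theorem ZS_zero (J : Finset ι) : (ZS f J 0 0).card = 1 := by
  simp [ZS, filter_singleton]

theorem ZS_avg (J : Finset ι) (m s : ℕ) (hs : s ≤ m) (v : V) :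
    ∑ I ∈ J.powersetCard m, (ZS f I s v).card =
      (J.card - s).choose (m - s) * (ZS f J s v).card := by
  have : ∑ I ∈ J.powersetCard m, (ZS f I s v).card =
      ∑ T ∈ ZS f J s v, ((J.powersetCard m).filter (T ⊆ ·)).card := by
    simp only [card_eq_sum_ones]
    refine sum_comm' fun I T => ?_
    simp only [mem_ZS, mem_filter, mem_powersetCard]
    constructor
    · rintro ⟨⟨h1, h2⟩, ⟨h3, h4⟩, h5⟩
      exact ⟨⟨⟨h1, h2⟩, h3⟩, ⟨h3.trans h1, h4⟩, h5⟩
    · tauto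
  rw [this, sum_congr rfl (g := fun _ => (J.card - s).choose (m - s)), sum_const, smul_eq_mul, mul_comm]
  intro T hT
  rw [mem_ZS] at hT
  rw [card_filter_powersetCard_subset _ _ _ hT.1.1 (by omega), hT.1.2]
end ZSlemmas

section prime
variable {ι : Type} [DecidableEq ι] {p : ℕ} [Fact p.Prime] (f : ι → ZMod p × ZMod p)

theorem alt_count (J : Finset ι) (hJ : J.card < 4 * p) (c : ZMod p) :
    ∑ T ∈ J.powerset, (-1 : ZMod p) ^ T.card * ind0 p ((0, c) + ∑ i ∈ T, (f i, (1 : ZMod p))) =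
      ∑ s ∈ (range (4 * p)).filter (fun s : ℕ => c + (s : ZMod p) = 0),
        (-1) ^ s * ((ZS f J s 0).card : ZMod p) := by
  rw [sum_powerset, sum_subset (s₂ := range (4 * p)) (range_subset_range.2 (by omega)), sum_filter]
  · refine sum_congr rfl fun s hs => ?_
    have e : ∀ T ∈ J.powersetCard s, (-1 : ZMod p) ^ T.card * 
        ind0 p ((0, c) + ∑ i ∈ T, (f i, (1 : ZMod p))) =
        if c + (s : ZMod p) = 0 then (if ∑ i ∈ T, f i = 0 then (-1) ^ s else 0) else 0 := by
      intro T hT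
      rw [mem_powersetCard] at hT
      have : ∑ i ∈ T, (f i, (1 : ZMod p)) = (∑ i ∈ T, f i, (s : ZMod p)) := by
        rw [← hT.2]
        ext <;> simp [Prod.fst_sum, Prod.snd_sum]
      rw [this, hT.2]
      simp only [ind0, Prod.mk_add_mk, zero_add, Prod.mk_eq_zero]
      split_ifs <;> simp_all
    rw [sum_congr rfl e]
    split_ifs
    · rw [← sum_filter, sum_const, nsmul_eq_mul, mul_comm]; rfl
    · simp
  · intro s _ hs
    rw [powersetCard_eq_empty.2 (by simpa using hs)]; simp

theorem filt0 : (range (4 * p)).filter (fun s : ℕ => (0 : ZMod p) + (s : ZMod p) = 0) =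
    {0, p, 2 * p, 3 * p} := by
  have hp := (Fact.out : p.Prime).two_le
  ext s
  simp only [zero_add, ZMod.natCast_eq_zero_iff, mem_filter, mem_range, mem_insert, mem_singleton]
  constructor
  · rintro ⟨h, q, rfl⟩
    have : q < 4 := by rw [mul_comm] at h; exact lt_of_mul_lt_mul_right h (by omega)
    interval_cases q <;> omega
  · rintro (rfl | rfl | rfl | rfl) <;> exact ⟨by omega, by simp⟩

theorem filt1 : (range (4 * p)).filter (fun s : ℕ => (1 : ZMod p) + (s : ZMod p) = 0) =
    {p - 1, 2 * p - 1, 3 * p - 1, 4 * p - 1} := by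
  have hp := (Fact.out : p.Prime).two_le
  ext s
  have : (1 : ZMod p) + s = ((s + 1 : ℕ) : ZMod p) := by push_cast; ring
  simp only [this, ZMod.natCast_eq_zero_iff, mem_filter, mem_range, mem_insert, mem_singleton]
  constructor
  · rintro ⟨h, q, hq⟩
    have h' : p * q < p * 5 := by omega
    have : q < 5 := lt_of_mul_lt_mul_left h' (by omega)
    interval_cases q <;> omega
  · rintro (rfl | rfl | rfl | rfl)
    · exact ⟨by omega, ⟨1, by omega⟩⟩
    · exact ⟨by omega, ⟨2, by omega⟩⟩
    · exact ⟨by omega, ⟨3, by omega⟩⟩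
    · exact ⟨by omega, ⟨4, by omega⟩⟩

theorem sum0 (hodd : Odd p) (J : Finset ι) (hJ : J.card < 4 * p) :
    ∑ T ∈ J.powerset, (-1 : ZMod p) ^ T.card * ind0 p ((0, 0) + ∑ i ∈ T, (f i, (1 : ZMod p))) =
      1 - (ZS f J p 0).card + (ZS f J (2 * p) 0).card - (ZS f J (3 * p) 0).card := by
  have hp := (Fact.out : p.Prime).two_le
  rw [alt_count f J hJ, filt0, sum_insert (by simp; omega), sum_insert (by simp; omega),
    sum_insert (by simp; omega), sum_singleton, ZS_zero, hodd.neg_one_pow,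
    (even_two_mul p).neg_one_pow, (Odd.mul (by decide : Odd 3) hodd).neg_one_pow]
  push_cast; ring

theorem sum1 (hodd : Odd p) (J : Finset ι) (hJ : J.card < 4 * p - 1) :
    ∑ T ∈ J.powerset, (-1 : ZMod p) ^ T.card * ind0 p ((0, 1) + ∑ i ∈ T, (f i, (1 : ZMod p))) =
      (ZS f J (p - 1) 0).card - (ZS f J (2 * p - 1) 0).card + (ZS f J (3 * p - 1) 0).card := by
  have hp := (Fact.out : p.Prime).two_le
  obtain ⟨m, hm⟩ := hodd
  rw [alt_count f J (by omega), filt1, sum_insert (by simp; omega), sum_insert (by simp; omega),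
    sum_insert (by simp; omega), sum_singleton, ZS_large f hJ,
    Even.neg_one_pow ⟨m, by omega⟩, Odd.neg_one_pow ⟨p - 1, by omega⟩, 
    Even.neg_one_pow (n := 3 * p - 1) ⟨3 * m + 1, by omega⟩]
  simp; ring

theorem cwA (hodd : Odd p) (J : Finset ι) (h1 : 3 * p - 2 ≤ J.card) (hJ : J.card < 4 * p) :
    (1 : ZMod p) - (ZS f J p 0).card + (ZS f J (2 * p) 0).card - (ZS f J (3 * p) 0).card = 0 := by
  have hp := (Fact.out : p.Prime).two_le
  rw [← sum0 f hodd J hJ]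
  exact FDPoly.alt _ J _ ((ind0_poly p).mono (by omega)) _

theorem cwB (hodd : Odd p) (J : Finset ι) (h1 : 3 * p - 3 ≤ J.card) (hJ : J.card < 4 * p - 1) :
    (1 : ZMod p) - (ZS f J p 0).card + (ZS f J (2 * p) 0).card - (ZS f J (3 * p) 0).card = 
    (ZS f J (p - 1) 0).card - (ZS f J (2 * p - 1) 0).card + (ZS f J (3 * p - 1) 0).card := by
  have hp := (Fact.out : p.Prime).two_le
  rw [← sum0 f hodd J (by omega), ← sum1 f hodd J hJ, ← sub_eq_zero, ← sum_sub_distrib]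
  have := FDPoly.alt (fun i => (f i, (1 : ZMod p))) J
    (fun x => ind0 p x - ind0 p (x + (0, 1)))
    (FDPoly.mono (n := (p - 1) + (p - 1) + (p - 1)) (by omega) (ind0_poly p _)) (0, 0)
  refine Eq.trans ?_ this
  refine sum_congr rfl fun T _ => ?_
  rw [← mul_sub, add_right_comm ((0, 0) : (ZMod p × ZMod p) × ZMod p)]
  simp

theorem choose_p (n q t : ℕ) (hn : n = q * p + t) (ht : t < p) : ((n.choose p : ℕ) : ZMod p) = q := by
  have hp := (Fact.out : p.Prime).two_le
  have := Choose.choose_modEq_choose_mod_mul_choose_div_nat (n := n) (k := p) (p := p)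
  rw [ZMod.natCast_eq_natCast_iff]
  have e : n / p = q := by
    rw [hn]; rw [mul_comm, Nat.mul_add_div (by omega), Nat.div_eq_of_lt ht]; rfl
  rw [e, Nat.mod_self, Nat.div_self (by omega)] at this
  simpa using this

theorem zs_3p (hodd : Odd p) (X : Finset ι) (h0 : ZS f X p 0 = ∅) :
    ZS f X (3 * p) 0 = ∅ := by
  have hp := (Fact.out : p.Prime).two_le
  by_contra hne
  obtain ⟨Y, hY⟩ := nonempty_iff_ne_empty.2 hne
  rw [mem_ZS] at hY
  obtain ⟨⟨hYX, hYc⟩, hYs⟩ := hY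
  have hYne : Y.Nonempty := card_pos.1 (by omega)
  obtain ⟨y, hy⟩ := hYne
  have hc : (Y.erase y).card = 3 * p - 1 := by rw [card_erase_of_mem hy, hYc]
  have sub : Y.erase y ⊆ Y := erase_subset _ _
  have hA := cwA f hodd (Y.erase y) (by omega) (by omega)
  have e1 : ZS f (Y.erase y) p 0 = ∅ := subset_empty.1 (h0 ▸ ZS_mono f (sub.trans hYX) p 0)
  have e2 : ZS f Y p 0 = ∅ := subset_empty.1 (h0 ▸ ZS_mono f (hYX) p 0)
  have e3 : ZS f Y (2 * p) 0 = ∅ := by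
    rw [← card_eq_zero, ZS_compl f Y (2 * p) p (by omega) 0 0 (by simp [hYs]), e2, card_empty]
  have e4 : ZS f (Y.erase y) (2 * p) 0 = ∅ := subset_empty.1 (e3 ▸ ZS_mono f sub _ 0)
  rw [e1, e4, ZS_large f (s := 3 * p) (by omega)] at hA
  simp at hA

theorem kemnitz_prime (hodd : Odd p) (X : Finset ι) (hX : X.card = 4 * p - 3) :
    (ZS f X p 0).Nonempty := by
  have hp2 := (Fact.out : p.Prime).two_le
  have hp : 3 ≤ p := by obtain ⟨m, hm⟩ := hodd; omega
  rw [nonempty_iff_ne_empty]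
  intro h0
  have h3 := zs_3p f hodd X h0
  have hsub : ∀ Y ⊆ X, ZS f Y p 0 = ∅ := fun Y h => subset_empty.1 (h0 ▸ ZS_mono f h p 0)
  have hsub3 : ∀ Y ⊆ X, ZS f Y (3 * p) 0 = ∅ := fun Y h => subset_empty.1 (h3 ▸ ZS_mono f h _ 0)
  have key : ∀ Y ⊆ X, 3 * p - 2 ≤ Y.card → ((ZS f Y (2 * p) 0).card : ZMod p) = -1 := by
    intro Y hY hc
    have := cwA f hodd Y hc (by have := card_le_card hY; omega)
    rw [hsub Y hY, hsub3 Y hY] at this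
    simp at this
    linear_combination this
  -- the relation between `p - 1` and `3 p - 1`
  have h5 : ((ZS f X (p - 1) 0).card : ZMod p) = (ZS f X (3 * p - 1) 0).card := by
    have c1 := ZS_swap f X (p - 1) (2 * p) 0 0
    have c2 := ZS_swap f X (p - 2) (2 * p) (∑ i ∈ X, f i) 0
    have c3 : ∑ C ∈ ZS f X (2 * p) 0, (ZS f (X \ C) (p - 1) 0).card =
        ∑ C ∈ ZS f X (2 * p) 0, (ZS f (X \ C) (p - 2) (∑ i ∈ X, f i)).card := by
      refine sum_congr rfl fun C hC => ?_
      rw [mem_ZS] at hC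
      refine ZS_compl f _ _ _ ?_ _ _ ?_
      · rw [card_sdiff_of_subset hC.1.1]; omega
      · rw [← sum_sdiff hC.1.1, hC.2]; simp
    have c4 := c1.trans (c3.trans c2.symm)
    have c5 : ∀ (s : ℕ) (u : ZMod p × ZMod p), s ≤ p - 1 → 
        ((∑ A ∈ ZS f X s u, (ZS f (X \ A) (2 * p) 0).card : ℕ) : ZMod p) = 
          - ((ZS f X s u).card : ZMod p) := by
      intro s u hs
      rw [Nat.cast_sum, sum_congr rfl (g := fun _ => (-1 : ZMod p))]
      · simp
      · intro A hA
        rw [mem_ZS] at hA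
        apply key _ sdiff_subset
        rw [card_sdiff_of_subset hA.1.1]; omega
    have c6 := congrArg (Nat.cast : ℕ → ZMod p) c4
    rw [c5 _ _ le_rfl, c5 _ _ (by omega), neg_inj] at c6
    rw [c6, ZS_compl f X (p - 2) (3 * p - 1) (by omega) _ 0 (by simp)]
  have h6 := cwB f hodd X (by omega) (by omega)
  have h7 := cwA f hodd X (by omega) (by omega)
  rw [h7] at h6
  have h2 := key X subset_rfl (by omega)
  -- averaging
  have hav : ∑ I ∈ X.powersetCard (3 * p - 3), ((1 : ZMod p) + (ZS f I (2 * p) 0).card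
      - (ZS f I (p - 1) 0).card + (ZS f I (2 * p - 1) 0).card) = 0 := by
    refine sum_eq_zero fun I hI => ?_
    rw [mem_powersetCard] at hI
    have := cwB f hodd I (by omega) (by omega)
    rw [hsub I hI.1, hsub3 I hI.1, ZS_large f (s := 3 * p - 1) (by omega)] at this
    simp at this
    linear_combination this
  rw [sum_add_distrib, sum_sub_distrib, sum_add_distrib, ← Nat.cast_sum, ← Nat.cast_sum,
    ← Nat.cast_sum, ZS_avg _ _ _ _ (by omega), ZS_avg _ _ _ _ (by omega), 
    ZS_avg _ _ _ _ (by omega), sum_const, card_powersetCard, nsmul_eq_mul, hX] at hav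
  have b : ∀ s q t, s ≤ 3 * p - 3 → 4 * p - 3 - s = q * p + t → t < p →
      (((4 * p - 3 - s).choose (3 * p - 3 - s) : ℕ) : ZMod p) = q := by
    intro s q t hs hq ht
    rw [← Nat.choose_symm (by omega), show 4 * p - 3 - s - (3 * p - 3 - s) = p by omega]
    exact choose_p _ q t hq ht
  have b0 := b 0 3 (p - 3) (by omega) (by omega) (by omega)
  simp only [Nat.sub_zero] at b0
  push_cast at hav
  rw [b0, b (2 * p) 1 (p - 3) (by omega) (by omega) (by omega),
    b (p - 1) 2 (p - 2) (by omega) (by omega) (by omega),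
    b (2 * p - 1) 1 (p - 2) (by omega) (by omega) (by omega), h2] at hav
  push_cast at hav
  have : (2 : ZMod p) = 0 := by
    linear_combination hav - h6 + h5
  have h2' : ((2 : ℕ) : ZMod p) = 0 := by exact_mod_cast this
  rw [ZMod.natCast_eq_zero_iff] at h2'
  have := Nat.le_of_dvd (by norm_num) h2'
  omega

end prime

/-- The Kemnitz property. -/
def Kem (n : ℕ) : Prop := ∀ (ι : Type) [DecidableEq ι] (J : Finset ι) (a b : ι → ℤ),
  4 * n - 3 ≤ J.card → ∃ T ⊆ J, T.card = n ∧ (n : ℤ) ∣ ∑ i ∈ T, a i ∧ (n : ℤ) ∣ ∑ i ∈ T, b i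

theorem Kem_prime (p : ℕ) (hp : p.Prime) (hodd : Odd p) : Kem p := by
  intro ι _ J a b hJ
  have := Fact.mk hp
  obtain ⟨X, hXJ, hX⟩ := exists_subset_card_eq hJ
  obtain ⟨T, hT⟩ := kemnitz_prime (p := p) (fun i => ((a i : ZMod p), (b i : ZMod p))) hodd X hX
  rw [mem_ZS] at hT
  refine ⟨T, hT.1.1.trans hXJ, hT.1.2, ?_, ?_⟩
  · have := congrArg Prod.fst hT.2
    rw [← ZMod.intCast_zmod_eq_zero_iff_dvd]
    simpa [Prod.fst_sum] using this
  · have := congrArg Prod.snd hT.2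
    rw [← ZMod.intCast_zmod_eq_zero_iff_dvd]
    simpa [Prod.snd_sum] using this

theorem blocks {ι : Type} [DecidableEq ι] (P : Finset ι → Prop) (L n : ℕ)
    (h : ∀ J : Finset ι, L ≤ J.card → ∃ T ⊆ J, T.card = n ∧ P T) (m : ℕ) :
    ∀ J : Finset ι, L + m * n ≤ J.card + n → ∃ B : ℕ → Finset ι,
      (∀ i < m, B i ⊆ J ∧ (B i).card = n ∧ P (B i)) ∧ 
      ∀ i < m, ∀ j < m, i ≠ j → Disjoint (B i) (B j) := by
  induction m with
  | zero => intro J _; exact ⟨fun _ => ∅, by simp, by simp⟩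
  | succ m ih =>
    intro J hJ
    rw [add_mul, one_mul] at hJ
    obtain ⟨T, hT, hTc, hTP⟩ := h J (by have := Nat.zero_le (m * n); omega)
    obtain ⟨B, hB, hd⟩ := ih (J \ T) (by
      rw [card_sdiff_of_subset hT]; have := card_le_card hT; omega)
    have hBT : ∀ i < m, Disjoint (B i) T := fun i hi => (subset_sdiff.1 (hB i hi).1).2
    refine ⟨fun i => if i < m then B i else T, ?_, ?_⟩
    · intro i _
      by_cases hi : i < m
      · simp only [hi, if_true]
        exact ⟨(hB i hi).1.trans sdiff_subset, (hB i hi).2⟩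
      · simp only [hi, if_false]; exact ⟨hT, hTc, hTP⟩
    · intro i _ j _ hij
      by_cases hi : i < m <;> by_cases hj : j < m <;> simp only [hi, hj, if_true, if_false]
      · exact hd i hi j hj hij
      · exact hBT i hi
      · exact (hBT j hj).symm
      · omega

theorem blocks_union {ι : Type} [DecidableEq ι] {J : Finset ι} (P : Finset ι → Prop) {n m : ℕ}
    {B : ℕ → Finset ι} (hB : ∀ i < m, B i ⊆ J ∧ (B i).card = n ∧ P (B i))
    (hd : ∀ i < m, ∀ j < m, i ≠ j → Disjoint (B i) (B j)) (S : Finset ℕ) (hS : S ⊆ range m) :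
    S.biUnion B ⊆ J ∧ (S.biUnion B).card = S.card * n ∧ 
      ∀ a : ι → ℤ, ∑ i ∈ S.biUnion B, a i = ∑ j ∈ S, ∑ i ∈ B j, a i := by
  have hS' : ∀ i ∈ S, i < m := fun i hi => mem_range.1 (hS hi)
  have hdd : (S : Set ℕ).PairwiseDisjoint B := fun i hi j hj hij => hd i (hS' i hi) j (hS' j hj) hij
  refine ⟨biUnion_subset.2 fun i hi => (hB i (hS' i hi)).1, ?_, fun a => sum_biUnion hdd⟩
  rw [card_biUnion hdd, sum_congr rfl fun i hi => (hB i (hS' i hi)).2.1, sum_const, smul_eq_mul]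

theorem Kem_mul (n m : ℕ) (hm : 0 < m) (hn : Kem n) (hm' : Kem m) : Kem (n * m) := by
  intro ι _ J a b hJ
  rcases Nat.eq_zero_or_pos n with rfl | hn0
  · exact ⟨∅, by simp⟩
  have hnm : n ≤ n * m := Nat.le_mul_of_pos_right n hm
  obtain ⟨B, hB, hd⟩ := blocks (fun T => (n : ℤ) ∣ ∑ i ∈ T, a i ∧ (n : ℤ) ∣ ∑ i ∈ T, b i)
    (4 * n - 3) n (fun J hJ => hn ι J a b hJ) (4 * m - 3) J (by
      have : (4 * m - 3) * n + 3 * n = 4 * (n * m) := by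
        rw [← add_mul, Nat.sub_add_cancel (by omega)]; ring
      omega)
  obtain ⟨S, hS, hSc, h1, h2⟩ := hm' ℕ (range (4 * m - 3)) (fun j => (∑ i ∈ B j, a i) / n)
    (fun j => (∑ i ∈ B j, b i) / n) (by simp)
  obtain ⟨u1, u2, u3⟩ := blocks_union
    (fun T => (n : ℤ) ∣ ∑ i ∈ T, a i ∧ (n : ℤ) ∣ ∑ i ∈ T, b i) hB hd S hS
  refine ⟨S.biUnion B, u1, by rw [u2, hSc, mul_comm], ?_, ?_⟩
  · rw [u3, sum_congr rfl fun j hj => (Int.mul_ediv_cancel' (hB j (mem_range.1 (hS hj))).2.2.1).symm,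
      ← mul_sum]
    push_cast
    exact mul_dvd_mul_left _ h1
  · rw [u3, sum_congr rfl fun j hj => (Int.mul_ediv_cancel' (hB j (mem_range.1 (hS hj))).2.2.2).symm,
      ← mul_sum]
    push_cast
    exact mul_dvd_mul_left _ h2

theorem Kem_odd (n : ℕ) : Odd n → Kem n := by
  induction n using Nat.recOnMul with
  | zero => intro h; simp at h
  | one =>
    intro _ ι _ J a b hJ
    obtain ⟨x, hx⟩ := card_pos.1 (show 0 < J.card by omega)
    exact ⟨{x}, by simpa using hx, by simp⟩
  | prime p hp => exact Kem_prime p hp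
  | mul a b ha hb =>
    intro h
    rw [Nat.odd_mul] at h
    exact Kem_mul a b h.2.pos (ha h.1) (hb h.2)

theorem Kem_rk (r m : ℕ) (hr : Odd r) (hm : 0 < m) {ι : Type} [DecidableEq ι] (J : Finset ι)
    (a b : ι → ℤ) (hJ : 2 * (r * m) + 2 * r - 3 ≤ J.card) :
    ∃ T ⊆ J, T.card = r * m ∧ (r : ℤ) ∣ ∑ i ∈ T, a i ∧ ((r * m : ℕ) : ℤ) ∣ ∑ i ∈ T, b i := by
  have hr0 := hr.pos
  have hnm : r ≤ r * m := Nat.le_mul_of_pos_right r hm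
  obtain ⟨B, hB, hd⟩ := blocks (fun T => (r : ℤ) ∣ ∑ i ∈ T, a i ∧ (r : ℤ) ∣ ∑ i ∈ T, b i)
    (4 * r - 3) r (fun J hJ => Kem_odd r hr ι J a b hJ) (2 * m - 1) J (by
      have : (2 * m - 1) * r + r = 2 * (r * m) := by
        rw [← Nat.succ_mul, Nat.succ_eq_add_one, Nat.sub_add_cancel (by omega)]; ring
      omega)
  obtain ⟨S, hS, hSc, h2⟩ := Int.erdos_ginzburg_ziv (n := m) (s := range (2 * m - 1))
    (fun j => (∑ i ∈ B j, b i) / r) (by simp)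
  obtain ⟨u1, u2, u3⟩ := blocks_union
    (fun T => (r : ℤ) ∣ ∑ i ∈ T, a i ∧ (r : ℤ) ∣ ∑ i ∈ T, b i) hB hd S hS
  refine ⟨S.biUnion B, u1, by rw [u2, hSc, mul_comm], ?_, ?_⟩
  · rw [u3]
    exact dvd_sum fun j hj => (hB j (mem_range.1 (hS hj))).2.2.1
  · rw [u3, sum_congr rfl fun j hj => (Int.mul_ediv_cancel' (hB j (mem_range.1 (hS hj))).2.2.2).symm,
      ← mul_sum]
    push_cast
    exact mul_dvd_mul_left _ h2

theorem two_eSym {n : ℕ} {R : Type*} [CommRing R] (g : Fin n → R) (J : Finset (Fin n)) :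
    2 * eSym 2 g J = (∑ i ∈ J, g i) ^ 2 - ∑ i ∈ J, g i ^ 2 := by
  induction J using Finset.induction_on with
  | empty => simp [eSym, powersetCard_eq_empty.2 (show (∅ : Finset (Fin n)).card < 2 by simp)]
  | insert x J hx ih =>
    have : eSym 2 g (insert x J) = eSym 2 g J + g x * ∑ i ∈ J, g i := by
      unfold eSym
      rw [powersetCard_succ_insert hx, sum_union, sum_image]
      · congr 1
        rw [powersetCard_one, sum_map, mul_sum]
        refine sum_congr rfl fun i hi => ?_
        have : x ≠ i := fun h => hx (h ▸ hi)
        simp [prod_pair this]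
      · intro A hA C hC h
        have hA' : x ∉ A := fun h => hx ((mem_powersetCard.1 hA).1 h)
        have hC' : x ∉ C := fun h => hx ((mem_powersetCard.1 hC).1 h)
        rw [← erase_insert hA', ← erase_insert hC']
        exact congrArg (fun s => s.erase x) h
      · rw [disjoint_left]
        intro A hA hA'
        obtain ⟨C, _, rfl⟩ := mem_image.1 hA'
        exact hx ((mem_powersetCard.1 hA).1 (mem_insert_self _ _))
    rw [this, sum_insert hx, sum_insert hx]
    linear_combination ih

theorem stmt_15 (k r ℓ : ℕ) (hk : Odd k) (hℓ : 1 ≤ ℓ) (hrk : r ∣ k) (hkr : k ∣ r ^ 2)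
    (g : Fin ((ℓ + 1) * k + 2 * r - 3) → ZMod k) :
    ∃ J : Finset (Fin ((ℓ + 1) * k + 2 * r - 3)), J.card = ℓ * k ∧ eSym 2 g J = 0 := by
  have hr : Odd r := Odd.of_dvd_nat hk hrk
  obtain ⟨m, rfl⟩ := hrk
  have hm : 0 < m := Nat.pos_of_ne_zero (by rintro rfl; simp at hk)
  have hr0 := hr.pos
  have hk0 := hk.pos
  have : NeZero (r * m) := ⟨hk0.ne'⟩
  set a : Fin ((ℓ + 1) * (r * m) + 2 * r - 3) → ℤ := fun i => ((g i).val : ℤ) with ha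
  have hag : ∀ i, ((a i : ℤ) : ZMod (r * m)) = g i := by intro i; simp [ha]
  obtain ⟨B, hB, hd⟩ := blocks
    (fun T => (r : ℤ) ∣ ∑ i ∈ T, a i ∧ ((r * m : ℕ) : ℤ) ∣ ∑ i ∈ T, a i ^ 2)
    (2 * (r * m) + 2 * r - 3) (r * m) (fun J hJ => Kem_rk r m hr hm J a (fun i => a i ^ 2) hJ)
    ℓ univ (by rw [card_univ, Fintype.card_fin, add_mul, one_mul]; omega)
  obtain ⟨-, u2, u3⟩ := blocks_union
    (fun T => (r : ℤ) ∣ ∑ i ∈ T, a i ∧ ((r * m : ℕ) : ℤ) ∣ ∑ i ∈ T, a i ^ 2) hB hd (range ℓ) subset_rfl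
  refine ⟨(range ℓ).biUnion B, by rw [u2, card_range], ?_⟩
  have h1 : (r : ℤ) ∣ ∑ i ∈ (range ℓ).biUnion B, a i := by
    rw [u3]; exact dvd_sum fun j hj => (hB j (mem_range.1 hj)).2.2.1
  have h2 : ((r * m : ℕ) : ℤ) ∣ ∑ i ∈ (range ℓ).biUnion B, a i ^ 2 := by
    rw [u3]; exact dvd_sum fun j hj => (hB j (mem_range.1 hj)).2.2.2
  have h3 : ((r * m : ℕ) : ℤ) ∣ (∑ i ∈ (range ℓ).biUnion B, a i) ^ 2 :=
    (by exact_mod_cast hkr : ((r * m : ℕ) : ℤ) ∣ (r : ℤ) ^ 2).trans (pow_dvd_pow_of_dvd h1 2)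
  rw [← ZMod.intCast_zmod_eq_zero_iff_dvd] at h2 h3
  push_cast [hag] at h2 h3
  have h4 := two_eSym g ((range ℓ).biUnion B)
  rw [h2, h3, sub_zero] at h4
  have hu : IsUnit (2 : ZMod (r * m)) := by
    have := (ZMod.isUnit_iff_coprime 2 (r * m)).2 (Nat.coprime_two_left.2 hk)
    exact_mod_cast this
  exact (hu.mul_right_eq_zero).1 h4
end

section
/- Let k be a positive integer with gcd(k, 3) = 1. Then every sequence over ℤ/kℤ of length 4k − 3 contains a subsequence S' of length k with e₃(S') ≡ 0 (mod k). That is, EGZ_k^{(3)}(ℤ_k) ≤ 4k − 3. -/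
open Finset

theorem alt_sum_prod {ι R κ : Type*} [DecidableEq ι] [CommRing R] [DecidableEq κ] (l : κ → ι → R)
    (T : Finset ι) : ∀ D : Finset κ, D.card < T.card →
    ∑ S ∈ T.powerset, (-1 : R) ^ S.card * ∏ j ∈ D, ∑ i ∈ S, l j i = 0 := by
  induction T using Finset.induction_on with
  | empty => intro D h; simp at h
  | insert a T ha ih =>
    intro D hD
    rw [card_insert_of_notMem ha] at hD
    rw [sum_powerset_insert ha, ← sum_add_distrib]
    have key : ∀ S ∈ T.powerset, (-1 : R) ^ S.card * ∏ j ∈ D, ∑ i ∈ S, l j i +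
        (-1 : R) ^ (insert a S).card * ∏ j ∈ D, ∑ i ∈ insert a S, l j i =
        - ∑ E ∈ D.powerset.erase D, (∏ j ∈ D \ E, l j a) *
          ((-1 : R) ^ S.card * ∏ j ∈ E, ∑ i ∈ S, l j i) := by
      intro S hS
      have haS : a ∉ S := fun h => ha (mem_powerset.1 hS h)
      rw [card_insert_of_notMem haS]
      simp_rw [sum_insert haS, add_comm (l _ a)]
      rw [prod_add, ← add_sum_erase _ _ (mem_powerset_self D)]
      have : ∑ E ∈ D.powerset.erase D, (∏ j ∈ D \ E, l j a) *
          ((-1 : R) ^ S.card * ∏ j ∈ E, ∑ i ∈ S, l j i) = (-1 : R) ^ S.card *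
          ∑ E ∈ D.powerset.erase D, (∏ j ∈ E, ∑ i ∈ S, l j i) * (∏ j ∈ D \ E, l j a) := by
        rw [mul_sum]
        exact sum_congr rfl fun _ _ => by ring
      rw [this]
      simp only [sdiff_self, bot_eq_empty, prod_empty]
      ring
    rw [sum_congr rfl key, sum_neg_distrib, sum_comm, neg_eq_zero]
    refine sum_eq_zero fun E hE => ?_
    rw [← mul_sum, ih E, mul_zero]
    rw [mem_erase, mem_powerset] at hE
    have := card_lt_card (hE.2.ssubset_of_ne hE.1)
    omega

theorem alt_sum_mono {ι R : Type*} [DecidableEq ι] [CommRing R] (f g : ι → R)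
    (T : Finset ι) (α β γ : ℕ) (h : α + β + γ < T.card) :
    ∑ S ∈ T.powerset, (-1 : R) ^ S.card * ((S.card : R) ^ α * (∑ i ∈ S, f i) ^ β * (∑ i ∈ S, g i) ^ γ) = 0 := by
  have := alt_sum_prod (R := R) (κ := Fin α ⊕ Fin β ⊕ Fin γ)
    (Sum.elim (fun _ _ => 1) (Sum.elim (fun _ => f) (fun _ => g))) T univ (by simp; omega)
  rw [← this]
  refine sum_congr rfl fun S _ => ?_
  simp [Fintype.prod_sum_type, mul_assoc]

/-- number of zero-sum subsets of size n -/
def cnt {ι : Type*} [DecidableEq ι] (p : ℕ) (f g : ι → ZMod p) (n : ℕ) (T : Finset ι) : ℕ :=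
  ((T.powersetCard n).filter fun S => ∑ i ∈ S, f i = 0 ∧ ∑ i ∈ S, g i = 0).card

theorem alt_poly {ι : Type*} [DecidableEq ι] (p : ℕ) [hp : Fact p.Prime] (f g : ι → ZMod p)
    (Q : Polynomial (ZMod p)) (T : Finset ι) (h : Q.natDegree + 2 * (p - 1) < T.card)
    (hT : T.card < 4 * p) :
    ∑ n ∈ range (4 * p), (-1 : ZMod p) ^ n * Q.eval (n : ZMod p) * (cnt p f g n T : ZMod p) = 0 := by
  have h1 : ∑ S ∈ T.powerset, (-1 : ZMod p) ^ S.card * (Q.eval (S.card : ZMod p) *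
      (1 - (∑ i ∈ S, f i) ^ (p-1)) * (1 - (∑ i ∈ S, g i) ^ (p-1))) = 0 := by
    have e : ∀ S ∈ T.powerset, (-1 : ZMod p) ^ S.card * (Q.eval (S.card : ZMod p) *
      (1 - (∑ i ∈ S, f i) ^ (p-1)) * (1 - (∑ i ∈ S, g i) ^ (p-1))) =
      ∑ m ∈ range (Q.natDegree + 1), Q.coeff m * (
        (-1 : ZMod p) ^ S.card * ((S.card : ZMod p) ^ m * (∑ i ∈ S, f i) ^ 0 * (∑ i ∈ S, g i) ^ 0)
      - (-1 : ZMod p) ^ S.card * ((S.card : ZMod p) ^ m * (∑ i ∈ S, f i) ^ (p-1) * (∑ i ∈ S, g i) ^ 0)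
      - (-1 : ZMod p) ^ S.card * ((S.card : ZMod p) ^ m * (∑ i ∈ S, f i) ^ 0 * (∑ i ∈ S, g i) ^ (p-1))
      + (-1 : ZMod p) ^ S.card * ((S.card : ZMod p) ^ m * (∑ i ∈ S, f i) ^ (p-1) * (∑ i ∈ S, g i) ^ (p-1))) := by
      intro S _
      rw [Polynomial.eval_eq_sum_range, sum_mul, sum_mul, mul_sum]
      exact sum_congr rfl fun _ _ => by ring
    rw [sum_congr rfl e, sum_comm]
    refine sum_eq_zero fun m hm => ?_
    rw [mem_range] at hm
    rw [← mul_sum, sum_add_distrib, sum_sub_distrib, sum_sub_distrib, alt_sum_mono _ _ _ _ _ _ (by omega),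
      alt_sum_mono _ _ _ _ _ _ (by omega), alt_sum_mono _ _ _ _ _ _ (by omega),
      alt_sum_mono _ _ _ _ _ _ (by omega)]
    simp
  have ind : ∀ x : ZMod p, 1 - x ^ (p-1) = if x = 0 then 1 else 0 := by
    intro x
    split_ifs with hx
    · have := hp.out.two_le
      rw [hx, zero_pow (by omega), sub_zero]
    · rw [ZMod.pow_card_sub_one_eq_one hx, sub_self]
  rw [sum_powerset] at h1
  have h2 : ∀ n, ∑ S ∈ T.powersetCard n, (-1 : ZMod p) ^ S.card * (Q.eval (S.card : ZMod p) *
      (1 - (∑ i ∈ S, f i) ^ (p-1)) * (1 - (∑ i ∈ S, g i) ^ (p-1))) =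
      (-1 : ZMod p) ^ n * Q.eval (n : ZMod p) * (cnt p f g n T : ZMod p) := by
    intro n
    rw [cnt, card_filter, Nat.cast_sum, mul_sum]
    refine sum_congr rfl fun S hS => ?_
    rw [(mem_powersetCard.1 hS).2, ind, ind]
    by_cases h1 : ∑ i ∈ S, f i = 0 <;> by_cases h2 : ∑ i ∈ S, g i = 0 <;> simp [h1, h2]
  simp_rw [h2] at h1
  rw [← h1]
  symm
  refine sum_subset (range_subset_range.2 (by omega)) fun n _ hn => ?_
  have : cnt p f g n T = 0 := by
    rw [cnt, powersetCard_eq_empty.2 (by simpa using hn)]; simp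
  rw [this]; simp

theorem cnt_zero {ι : Type*} [DecidableEq ι] (p : ℕ) (f g : ι → ZMod p) (T : Finset ι) :
    cnt p f g 0 T = 1 := by simp [cnt, filter_singleton]

theorem cnt_large {ι : Type*} [DecidableEq ι] (p : ℕ) (f g : ι → ZMod p) (T : Finset ι) (n : ℕ)
    (h : T.card < n) : cnt p f g n T = 0 := by
  rw [cnt, powersetCard_eq_empty.2 h]; simp

theorem ind0_s18 (p : ℕ) [hp : Fact p.Prime] (x : ZMod p) : 1 - x ^ (p-1) = if x = 0 then 1 else 0 := by
  split_ifs with hx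
  · have := hp.out.two_le
    rw [hx, zero_pow (by omega), sub_zero]
  · rw [ZMod.pow_card_sub_one_eq_one hx, sub_self]

theorem sum_ind0 (p : ℕ) [hp : Fact p.Prime] (F : ℕ → ZMod p) :
    ∑ n ∈ range (4 * p), (if (n : ZMod p) = 0 then F n else 0) = F 0 + F p + F (2 * p) + F (3 * p) := by
  have h0 := hp.out.pos
  have : ∑ n ∈ ({0, p, 2 * p, 3 * p} : Finset ℕ), (if (n : ZMod p) = 0 then F n else 0) =
      F 0 + F p + F (2 * p) + F (3 * p) := by
    rw [sum_insert, sum_insert, sum_insert, sum_singleton]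
    · simp; ring
    all_goals simp; try omega
  rw [← this]
  symm
  refine sum_subset ?_ ?_
  · intro n; simp; omega
  · intro n hn hn'
    rw [if_neg]
    rw [ZMod.natCast_eq_zero_iff]
    rintro ⟨q, rfl⟩
    rw [mem_range, mul_comm] at hn
    have : q < 4 := lt_of_mul_lt_mul_right hn (Nat.zero_le _)
    apply hn'
    interval_cases q <;> simp [mul_comm]

theorem sum_ind1 (p : ℕ) [hp : Fact p.Prime] (F : ℕ → ZMod p) :
    ∑ n ∈ range (4 * p), (if (n : ZMod p) + 1 = 0 then F n else 0) =
      F (p-1) + F (2 * p-1) + F (3 * p-1) + F (4 * p - 1) := by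
  have h0 := hp.out.pos
  have h := sum_ind0 p (fun n => if n = 0 then 0 else F (n-1))
  have e : ∑ n ∈ range (4 * p + 1), (if (n : ZMod p) = 0 then (if n = 0 then 0 else F (n-1)) else 0)
     = F (p-1) + F (2 * p-1) + F (3 * p-1) + F (4 * p - 1) := by
    rw [sum_range_succ, h]
    have : p ≠ 0 := by omega
    simp [this]
  rw [sum_range_succ'] at e
  simpa using e


theorem par (p : ℕ) [hp : Fact p.Prime] (hodd : Odd p) : (-1 : ZMod p) ^ p = -1 ∧ (-1 : ZMod p) ^ (2*p) = 1 ∧ (-1 : ZMod p) ^ (3*p) = -1 ∧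
    (-1 : ZMod p) ^ (p-1) = 1 ∧ (-1 : ZMod p) ^ (2*p-1) = -1 ∧ (-1 : ZMod p) ^ (3*p-1) = 1 := by
  have := hp.out.pos
  refine ⟨hodd.neg_one_pow, ?_, ?_, ?_, ?_, ?_⟩
  · exact (even_two_mul p).neg_one_pow
  · exact (Odd.mul (by decide) hodd).neg_one_pow
  · exact (hodd.tsub_odd odd_one).neg_one_pow
  · exact (Nat.Even.sub_odd (by omega) (even_two_mul p) odd_one).neg_one_pow
  · exact ((Odd.mul (by decide) hodd).tsub_odd odd_one).neg_one_pow

theorem lemA {ι : Type*} [DecidableEq ι] (p : ℕ) [hp : Fact p.Prime] (hodd : Odd p)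
    (f g : ι → ZMod p) (T : Finset ι) (h : 3 * p - 2 ≤ T.card) (hT : T.card < 4 * p) :
    (1 : ZMod p) - cnt p f g p T + cnt p f g (2*p) T - cnt p f g (3*p) T = 0 := by
  have h2 := hp.out.two_le
  have := alt_poly p f g (1 - Polynomial.X ^ (p-1)) T (by
    have : (1 - Polynomial.X ^ (p-1) : Polynomial (ZMod p)).natDegree ≤ p - 1 := by compute_degree
    omega) hT
  obtain ⟨a, b, c, -, -, -⟩ := par p hodd
  simp only [Polynomial.eval_sub, Polynomial.eval_one, Polynomial.eval_pow, Polynomial.eval_X, ind0_s18,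
    mul_ite, ite_mul, mul_zero, zero_mul, mul_one] at this
  rw [sum_ind0 p (fun n => (-1) ^ n * (cnt p f g n T : ZMod p)), a, b, c, cnt_zero] at this
  linear_combination (norm := (push_cast; ring)) this

theorem lemB {ι : Type*} [DecidableEq ι] (p : ℕ) [hp : Fact p.Prime] (hodd : Odd p)
    (f g : ι → ZMod p) (T : Finset ι) (h : 3 * p - 2 ≤ T.card) (hT : T.card < 4 * p - 1) :
    (cnt p f g (p-1) T : ZMod p) - cnt p f g (2*p-1) T + cnt p f g (3*p-1) T = 0 := by
  have h2 := hp.out.two_le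
  have := alt_poly p f g (1 - (Polynomial.X + 1) ^ (p-1)) T (by
    have : (1 - (Polynomial.X + 1) ^ (p-1) : Polynomial (ZMod p)).natDegree ≤ p - 1 := by compute_degree
    omega) (by omega)
  obtain ⟨-, -, -, a, b, c⟩ := par p hodd
  simp only [Polynomial.eval_sub, Polynomial.eval_one, Polynomial.eval_pow, Polynomial.eval_X, ind0_s18,
    Polynomial.eval_add,
    mul_ite, ite_mul, mul_zero, zero_mul, mul_one] at this
  rw [sum_ind1 p (fun n => (-1) ^ n * (cnt p f g n T : ZMod p)), a, b, c, 
    cnt_large _ _ _ _ (4*p-1) hT] at this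
  linear_combination (norm := (push_cast; ring)) this

theorem lemC {ι : Type*} [DecidableEq ι] (p : ℕ) [hp : Fact p.Prime] (hodd : Odd p)
    (f g : ι → ZMod p) (T : Finset ι) (h : T.card = 3 * p - 3) :
    (1 : ZMod p) - cnt p f g (p-1) T - cnt p f g p T + cnt p f g (2*p-1) T + cnt p f g (2*p) T = 0 := by
  have h2 := hp.out.two_le
  have := alt_poly p f g (((Polynomial.X + 1) ^ (p-1) - Polynomial.X ^ (p-1))) T (by
    have : ((Polynomial.X + 1) ^ (p-1) - Polynomial.X ^ (p-1) : Polynomial (ZMod p)).natDegree ≤ p - 2 := by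
      rw [add_pow, sum_range_succ]
      simp only [one_pow, mul_one, Nat.choose_self, Nat.cast_one, add_sub_cancel_right]
      refine Polynomial.natDegree_sum_le_of_forall_le _ _ fun i hi => ?_
      rw [mem_range] at hi
      refine Polynomial.natDegree_mul_le.trans ?_
      rw [Polynomial.natDegree_X_pow, Polynomial.natDegree_natCast]
      omega
    have : p ≠ 2 := by rintro rfl; revert hodd; decide
    omega) (by omega)
  have e : ∀ x : ZMod p, (x+1)^(p-1) - x^(p-1) = (if x = 0 then 1 else 0) - (if x + 1 = 0 then 1 else 0) := by
    intro x; rw [← ind0_s18, ← ind0_s18]; ring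
  obtain ⟨a0, b0, c0, a, b, c⟩ := par p hodd
  simp only [Polynomial.eval_sub, Polynomial.eval_one, Polynomial.eval_pow, Polynomial.eval_X, e,
    Polynomial.eval_add, mul_sub, sub_mul, sum_sub_distrib,
    mul_ite, ite_mul, mul_zero, zero_mul, mul_one] at this
  rw [sum_ind0 p (fun n => (-1) ^ n * (cnt p f g n T : ZMod p)),
    sum_ind1 p (fun n => (-1) ^ n * (cnt p f g n T : ZMod p)), a, b, c, a0, b0, c0,
    cnt_large _ _ _ _ (4*p-1) (by omega), cnt_large _ _ _ _ (3*p-1) (by omega), 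
    cnt_large _ _ _ _ (3*p) (by omega), cnt_zero] at this
  linear_combination (norm := (push_cast; ring)) this

theorem cnt_pos {ι : Type*} [DecidableEq ι] {p : ℕ} {f g : ι → ZMod p} {n : ℕ} {T : Finset ι}
    (h : cnt p f g n T ≠ 0) :
    ∃ S ⊆ T, S.card = n ∧ ∑ i ∈ S, f i = 0 ∧ ∑ i ∈ S, g i = 0 := by
  rw [cnt, card_ne_zero] at h
  obtain ⟨S, hS⟩ := h
  simp only [mem_filter, mem_powersetCard] at hS
  exact ⟨S, hS.1.1, hS.1.2, hS.2⟩

theorem cnt_eq_zero_mono {ι : Type*} [DecidableEq ι] {p : ℕ} {f g : ι → ZMod p} {n : ℕ}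
    {T U : Finset ι} (hTU : T ⊆ U) (h : cnt p f g n U = 0) : cnt p f g n T = 0 := by
  rw [cnt, card_eq_zero] at h ⊢
  rw [← subset_empty, ← h]
  exact filter_subset_filter _ (powersetCard_mono hTU)

theorem cnt_ne_zero {ι : Type*} [DecidableEq ι] {p : ℕ} {f g : ι → ZMod p} {n : ℕ} {T S : Finset ι}
    (h : S ⊆ T) (h1 : S.card = n) (h2 : ∑ i ∈ S, f i = 0) (h3 : ∑ i ∈ S, g i = 0) :
    cnt p f g n T ≠ 0 := by
  rw [cnt, card_ne_zero]
  exact ⟨S, by simp [h, h1, h2, h3]⟩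

/-- if there is no zero-sum `p`-subset, the number of zero-sum `2p`-subsets is `-1`. -/
theorem cor2 {ι : Type*} [DecidableEq ι] (p : ℕ) [hp : Fact p.Prime] (hodd : Odd p)
    (f g : ι → ZMod p) (T : Finset ι) (h : 3 * p - 2 ≤ T.card) (hT : T.card < 3 * p)
    (h0 : cnt p f g p T = 0) : (cnt p f g (2 * p) T : ZMod p) = -1 := by
  have := lemA p hodd f g T h (by omega)
  rw [h0, cnt_large _ _ _ _ (3 * p) hT] at this
  linear_combination (norm := (push_cast; ring)) this

/-- Alon-Dubiner. -/
theorem alon_dubiner {ι : Type*} [DecidableEq ι] (p : ℕ) [hp : Fact p.Prime] (hodd : Odd p)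
    (f g : ι → ZMod p) (T : Finset ι) (h0 : cnt p f g p T = 0) : cnt p f g (3 * p) T = 0 := by
  by_contra h
  have hpp := hp.out.pos
  obtain ⟨S, hST, hS, hf, hg⟩ := cnt_pos h
  obtain ⟨a, ha⟩ : S.Nonempty := by rw [← card_pos]; omega
  have hc : (S.erase a).card = 3 * p - 1 := by rw [card_erase_of_mem ha, hS]
  have h1 := cor2 p hodd f g (S.erase a) (by omega) (by omega)
    (cnt_eq_zero_mono ((erase_subset _ _).trans hST) h0)
  have h2 : cnt p f g (2 * p) (S.erase a) ≠ 0 := by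
    intro h; rw [h] at h1; simp at h1
  obtain ⟨U, hU, hUc, hUf, hUg⟩ := cnt_pos h2
  have hUS : U ⊆ S := hU.trans (erase_subset _ _)
  refine cnt_ne_zero (S := S \ U) (sdiff_subset.trans hST) ?_ ?_ ?_ h0
  · rw [card_sdiff_of_subset hUS]; omega
  · have := sum_sdiff (f := f) hUS
    rw [hUf, hf, add_zero] at this; exact this
  · have := sum_sdiff (f := g) hUS
    rw [hUg, hg, add_zero] at this; exact this

theorem sum_cnt {ι : Type*} [DecidableEq ι] (p : ℕ) (f g : ι → ZMod p) (X : Finset ι) (m n : ℕ)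
    (hn : n ≤ m) :
    ∑ I ∈ X.powersetCard m, cnt p f g n I = (X.card - n).choose (m - n) * cnt p f g n X := by
  have h1 : ∀ I ∈ X.powersetCard m, cnt p f g n I = ∑ S ∈ (X.powersetCard n).filter
      (fun S => ∑ i ∈ S, f i = 0 ∧ ∑ i ∈ S, g i = 0), if S ⊆ I then 1 else 0 := by
    intro I hI
    rw [mem_powersetCard] at hI
    rw [← card_filter, cnt]
    congr 1
    ext S
    simp only [mem_filter, mem_powersetCard]
    constructor
    · rintro ⟨⟨a, b⟩, c⟩; exact ⟨⟨⟨a.trans hI.1, b⟩, c⟩, a⟩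
    · rintro ⟨⟨⟨a, b⟩, c⟩, d⟩; exact ⟨⟨d, b⟩, c⟩
  rw [sum_congr rfl h1, sum_comm, cnt, mul_comm, ← smul_eq_mul, ← sum_const]
  refine sum_congr rfl fun S hS => ?_
  simp only [mem_filter, mem_powersetCard] at hS
  obtain ⟨⟨hSX, hSn⟩, -⟩ := hS
  rw [← card_filter, ← hSn, ← card_sdiff_of_subset hSX, ← card_powersetCard]
  refine card_bij' (fun I _ => I \ S) (fun I _ => I ∪ S) ?_ ?_ ?_ ?_
  · intro I hI
    simp only [mem_filter, mem_powersetCard] at hI ⊢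
    exact ⟨sdiff_subset_sdiff hI.1.1 le_rfl, by rw [card_sdiff_of_subset hI.2, hI.1.2]⟩
  · intro I hI
    simp only [mem_filter, mem_powersetCard] at hI ⊢
    have hd : Disjoint I S := (subset_sdiff.1 hI.1).2
    refine ⟨⟨union_subset (hI.1.trans sdiff_subset) hSX, ?_⟩, subset_union_right⟩
    rw [card_union_of_disjoint hd, hI.2]; omega
  · intro I hI
    simp only [mem_filter, mem_powersetCard] at hI
    exact sdiff_union_of_subset hI.2
  · intro I hI
    simp only [mem_powersetCard] at hI
    exact union_sdiff_cancel_right (subset_sdiff.1 hI.1).2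

theorem choose_p_s18 (p : ℕ) [hp : Fact p.Prime] (n q r : ℕ) (h : n = q * p + r) (hr : r < p) :
    (n.choose p : ZMod p) = q := by
  have := Choose.choose_modEq_choose_mod_mul_choose_div_nat (n := n) (k := p) (p := p)
  rw [← ZMod.natCast_eq_natCast_iff] at this
  have hp0 := hp.out.pos
  rw [this, Nat.mod_self, Nat.div_self hp0, Nat.choose_zero_right, Nat.choose_one_right, one_mul]
  congr 1
  rw [h, mul_comm, Nat.mul_add_div hp0, Nat.div_eq_of_lt hr, add_zero]

theorem lem5 {ι : Type*} [DecidableEq ι] (p : ℕ) [hp : Fact p.Prime] (hodd : Odd p)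
    (f g : ι → ZMod p) (X : Finset ι) (hX : X.card = 4 * p - 3) :
    (3 : ZMod p) - 2 * cnt p f g (p-1) X - 2 * cnt p f g p X + cnt p f g (2*p-1) X
      + cnt p f g (2*p) X = 0 := by
  have h2 := hp.out.two_le
  have hp2 : p ≠ 2 := by rintro rfl; revert hodd; decide
  have h : ∑ I ∈ X.powersetCard (3 * p - 3), ((1 : ZMod p) - cnt p f g (p-1) I - cnt p f g p I
      + cnt p f g (2*p-1) I + cnt p f g (2*p) I) = 0 :=
    sum_eq_zero fun I hI => lemC p hodd f g I (mem_powersetCard.1 hI).2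
  have key : ∀ n q r : ℕ, n ≤ 3 * p - 3 → 4 * p - 3 - n = q * p + r → r < p →
      ∑ I ∈ X.powersetCard (3 * p - 3), (cnt p f g n I : ZMod p) = q * cnt p f g n X := by
    intro n q r hn hq hr
    rw [← Nat.cast_sum, sum_cnt _ _ _ _ _ _ hn, Nat.cast_mul, hX,
      ← Nat.choose_symm_of_eq_add (a := p) (by omega), choose_p_s18 p _ q r hq hr]
  simp only [sum_add_distrib, sum_sub_distrib] at h
  have k0 := key 0 3 (p - 3) (by omega) (by omega) (by omega)
  simp only [cnt_zero, Nat.cast_one, mul_one] at k0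
  rw [k0, key (p-1) 2 (p-2) (by omega) (by omega) (by omega),
    key p 2 (p-3) (by omega) (by omega) (by omega),
    key (2*p-1) 1 (p-2) (by omega) (by omega) (by omega),
    key (2*p) 1 (p-3) (by omega) (by omega) (by omega)] at h
  linear_combination (norm := (push_cast; ring)) h

theorem lem6 {ι : Type*} [DecidableEq ι] (p : ℕ) [hp : Fact p.Prime] (hodd : Odd p)
    (f g : ι → ZMod p) (X : Finset ι) (hX : X.card = 4 * p - 3) (h0 : cnt p f g p X = 0) :
    (cnt p f g (p-1) X : ZMod p) = cnt p f g (3*p-1) X := by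
  have h2 := hp.out.two_le
  have e1 : (∑ A ∈ (X.powersetCard (p-1)).filter (fun S => ∑ i ∈ S, f i = 0 ∧ ∑ i ∈ S, g i = 0),
      (cnt p f g (2 * p) (X \ A) : ZMod p)) = - cnt p f g (p-1) X := by
    rw [sum_congr rfl (g := fun _ => -1), sum_const, nsmul_eq_mul, cnt]
    · ring
    · intro A hA
      simp only [mem_filter, mem_powersetCard] at hA
      have : (X \ A).card = 3 * p - 2 := by rw [card_sdiff_of_subset hA.1.1]; omega
      exact cor2 p hodd f g _ (by omega) (by omega) (cnt_eq_zero_mono sdiff_subset h0)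
  have e2 : (∑ D ∈ (X.powersetCard (3*p-1)).filter (fun S => ∑ i ∈ S, f i = 0 ∧ ∑ i ∈ S, g i = 0),
      (cnt p f g (2 * p) D : ZMod p)) = - cnt p f g (3*p-1) X := by
    rw [sum_congr rfl (g := fun _ => -1), sum_const, nsmul_eq_mul, cnt]
    · ring
    · intro A hA
      simp only [mem_filter, mem_powersetCard] at hA
      exact cor2 p hodd f g _ (by omega) (by omega) (cnt_eq_zero_mono hA.1.1 h0)
  have e3 : (∑ A ∈ (X.powersetCard (p-1)).filter (fun S => ∑ i ∈ S, f i = 0 ∧ ∑ i ∈ S, g i = 0),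
      cnt p f g (2 * p) (X \ A)) =
      ∑ D ∈ (X.powersetCard (3*p-1)).filter (fun S => ∑ i ∈ S, f i = 0 ∧ ∑ i ∈ S, g i = 0),
      cnt p f g (2 * p) D := by
    simp only [cnt]
    rw [← card_sigma, ← card_sigma]
    refine card_bij' (fun x _ => ⟨x.1 ∪ x.2, x.2⟩) (fun x _ => ⟨x.1 \ x.2, x.2⟩) ?_ ?_ ?_ ?_
    · rintro ⟨A, C⟩ h
      simp only [mem_sigma, mem_filter, mem_powersetCard] at h ⊢
      obtain ⟨⟨⟨hA, hAc⟩, hAf, hAg⟩, ⟨hC, hCc⟩, hCf, hCg⟩ := h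
      have hd : Disjoint A C := (subset_sdiff.1 hC).2.symm
      refine ⟨⟨⟨union_subset hA (hC.trans sdiff_subset), ?_⟩, ?_, ?_⟩,
        ⟨subset_union_right, hCc⟩, hCf, hCg⟩
      · rw [card_union_of_disjoint hd]; omega
      · rw [sum_union hd, hAf, hCf, add_zero]
      · rw [sum_union hd, hAg, hCg, add_zero]
    · rintro ⟨D, C⟩ h
      simp only [mem_sigma, mem_filter, mem_powersetCard] at h ⊢
      obtain ⟨⟨⟨hD, hDc⟩, hDf, hDg⟩, ⟨hC, hCc⟩, hCf, hCg⟩ := h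
      refine ⟨⟨⟨sdiff_subset.trans hD, ?_⟩, ?_, ?_⟩,
        ⟨subset_sdiff.2 ⟨hC.trans hD, disjoint_sdiff⟩, hCc⟩, hCf, hCg⟩
      · rw [card_sdiff_of_subset hC]; omega
      · have := sum_sdiff (f := f) hC
        rw [hCf, hDf, add_zero] at this; exact this
      · have := sum_sdiff (f := g) hC
        rw [hCg, hDg, add_zero] at this; exact this
    · rintro ⟨A, C⟩ h
      simp only [mem_sigma, mem_filter, mem_powersetCard] at h ⊢
      rw [union_sdiff_cancel_right (subset_sdiff.1 h.2.1.1).2.symm]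
    · rintro ⟨D, C⟩ h
      simp only [mem_sigma, mem_filter, mem_powersetCard] at h ⊢
      rw [sdiff_union_of_subset h.2.1.1]
  have e4 := congrArg (Nat.cast : ℕ → ZMod p) e3
  rw [Nat.cast_sum, Nat.cast_sum, e1, e2] at e4
  exact neg_injective e4

theorem kemnitz_odd {ι : Type*} [DecidableEq ι] (p : ℕ) [hp : Fact p.Prime] (hodd : Odd p)
    (f g : ι → ZMod p) (X : Finset ι) (hX : X.card = 4 * p - 3) :
    ∃ S ⊆ X, S.card = p ∧ ∑ i ∈ S, f i = 0 ∧ ∑ i ∈ S, g i = 0 := by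
  have h2 := hp.out.two_le
  have hp2 : p ≠ 2 := by rintro rfl; revert hodd; decide
  apply cnt_pos
  intro h0
  have a := lemA p hodd f g X (by omega) (by omega)
  have b := lemB p hodd f g X (by omega) (by omega)
  have c := lem5 p hodd f g X hX
  have d := lem6 p hodd f g X hX h0
  rw [alon_dubiner p hodd f g X h0, h0] at a
  rw [h0] at c
  have : ((2 : ℕ) : ZMod p) = 0 := by
    push_cast at a c ⊢
    linear_combination c - a + b + d
  rw [ZMod.natCast_eq_zero_iff] at this
  exact hp2 ((Nat.prime_dvd_prime_iff_eq hp.out Nat.prime_two).1 this)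

theorem kemnitz_two {ι : Type*} [DecidableEq ι]
    (f g : ι → ZMod 2) (X : Finset ι) (hX : X.card = 5) :
    ∃ S ⊆ X, S.card = 2 ∧ ∑ i ∈ S, f i = 0 ∧ ∑ i ∈ S, g i = 0 := by
  obtain ⟨x, hx, y, hy, hxy, h⟩ := exists_ne_map_eq_of_card_lt_of_maps_to (s := X)
    (t := (univ : Finset (ZMod 2 × ZMod 2))) (f := fun i => (f i, g i))
    (by rw [hX]; decide) (fun _ _ => by simp)
  simp only [Prod.mk.injEq] at h
  refine ⟨{x, y}, by simp [insert_subset_iff, hx, hy], card_pair hxy, ?_, ?_⟩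
  · rw [sum_pair hxy, h.1]; exact CharTwo.add_self_eq_zero _
  · rw [sum_pair hxy, h.2]; exact CharTwo.add_self_eq_zero _

theorem kemnitz_int (n : ℕ) : ∀ {ι : Type} (s : Finset ι) (a b : ι → ℤ), 4 * n - 3 ≤ s.card →
    ∃ t ⊆ s, t.card = n ∧ (n : ℤ) ∣ ∑ i ∈ t, a i ∧ (n : ℤ) ∣ ∑ i ∈ t, b i := by
  classical
  induction n using Nat.prime_composite_induction with
  | zero => intro ι s a b _; exact ⟨∅, by simp⟩
  | one =>
    intro ι s a b hs
    obtain ⟨t, ht, hc⟩ := exists_subset_card_eq (s := s) (n := 1) (by omega)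
    exact ⟨t, ht, hc, by simp, by simp⟩
  | prime p hp =>
    intro ι s a b hs
    have := Fact.mk hp
    obtain ⟨t, hts, ht⟩ := exists_subset_card_eq hs
    have : ∃ S ⊆ t, S.card = p ∧ ∑ i ∈ S, (a i : ZMod p) = 0 ∧ ∑ i ∈ S, (b i : ZMod p) = 0 := by
      rcases hp.eq_two_or_odd' with rfl | ho
      · exact kemnitz_two _ _ t ht
      · exact kemnitz_odd p ho _ _ t ht
    obtain ⟨u, hu, hc, h1, h2⟩ := this
    refine ⟨u, hu.trans hts, hc, ?_, ?_⟩
    · rw [← ZMod.intCast_zmod_eq_zero_iff_dvd]; push_cast; exact h1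
    · rw [← ZMod.intCast_zmod_eq_zero_iff_dvd]; push_cast; exact h2
  | composite m hm ihm n hn ihn =>
    intro ι s a b hs
    suffices ∀ k ≤ 4 * m - 3, ∃ 𝒜 : Finset (Finset ι), #𝒜 = k ∧
      (𝒜 : Set (Finset ι)).Pairwise _root_.Disjoint ∧
        ∀ ⦃t⦄, t ∈ 𝒜 → t ⊆ s ∧ #t = n ∧ ((n : ℤ) ∣ ∑ i ∈ t, a i) ∧ (n : ℤ) ∣ ∑ i ∈ t, b i by
      obtain ⟨𝒜, h𝒜card, h𝒜disj, h𝒜⟩ := this _ le_rfl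
      obtain ⟨ℬ, hℬ𝒜, hℬcard, hℬ, hℬ'⟩ := ihm 𝒜 (fun t ↦ (∑ i ∈ t, a i) / n)
        (fun t ↦ (∑ i ∈ t, b i) / n) h𝒜card.ge
      refine ⟨ℬ.biUnion fun x ↦ x, biUnion_subset.2 fun t ht ↦ (h𝒜 <| hℬ𝒜 ht).1, ?_, ?_, ?_⟩
      · rw [card_biUnion (h𝒜disj.mono hℬ𝒜), sum_const_nat fun t ht ↦ (h𝒜 <| hℬ𝒜 ht).2.1, hℬcard]
      · rwa [sum_biUnion, Int.natCast_mul, mul_comm, ← Int.dvd_div_iff_mul_dvd, Int.sum_div]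
        · exact fun t ht ↦ (h𝒜 <| hℬ𝒜 ht).2.2.1
        · exact dvd_sum fun t ht ↦ (h𝒜 <| hℬ𝒜 ht).2.2.1
        · exact h𝒜disj.mono hℬ𝒜
      · rwa [sum_biUnion, Int.natCast_mul, mul_comm, ← Int.dvd_div_iff_mul_dvd, Int.sum_div]
        · exact fun t ht ↦ (h𝒜 <| hℬ𝒜 ht).2.2.2
        · exact dvd_sum fun t ht ↦ (h𝒜 <| hℬ𝒜 ht).2.2.2
        · exact h𝒜disj.mono hℬ𝒜
    rintro k hk
    induction k with
    | zero => exact ⟨∅, by simp⟩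
    | succ k ih =>
    obtain ⟨𝒜, h𝒜card, h𝒜disj, h𝒜⟩ := ih (Nat.le_of_succ_le hk)
    have : 4 * n - 3 ≤ #(s \ 𝒜.biUnion id) := by
      have c1 : #(𝒜.biUnion id) ≤ k * n := by
        refine card_biUnion_le.trans ?_
        simp only [id]
        rw [sum_const_nat fun t ht ↦ (h𝒜 ht).2.1, h𝒜card]
      have c2 := le_card_sdiff (𝒜.biUnion id) s
      have c3 : (k + 4) * n ≤ (4 * m) * n := Nat.mul_le_mul_right _ (by omega)
      have c4 : 4 * m * n = 4 * (m * n) := by ring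
      have c5 : (k + 4) * n = k * n + 4 * n := by ring
      generalize #(s \ 𝒜.biUnion id) = u at *
      generalize #(𝒜.biUnion id) = v at *
      clear h𝒜 h𝒜disj ih ihm ihn
      omega
    obtain ⟨t₀, ht₀, ht₀card, ht₀sum⟩ := ihn _ a b this
    have : t₀ ∉ 𝒜 := by
      rintro h
      obtain rfl : n = 0 := by
        simpa [← card_eq_zero, ht₀card] using sdiff_disjoint.mono ht₀ <| subset_biUnion_of_mem id h
      lia
    refine ⟨𝒜.cons t₀ this, by rw [card_cons, h𝒜card], ?_, ?_⟩
    · simp only [cons_eq_insert, coe_insert, Set.pairwise_insert_of_symm, mem_coe, ne_eq]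
      exact ⟨h𝒜disj, fun t ht _ ↦ sdiff_disjoint.mono ht₀ <| subset_biUnion_of_mem id ht⟩
    · simp only [cons_eq_insert, mem_insert, forall_eq_or_imp, and_assoc]
      exact ⟨ht₀.trans sdiff_subset, ht₀card, ht₀sum.1, ht₀sum.2, h𝒜⟩

theorem eSym_insert {n : ℕ} {R : Type*} [CommRing R] (m : ℕ) (g : Fin n → R) (J : Finset (Fin n))
    (a : Fin n) (ha : a ∉ J) : eSym (m+1) g (insert a J) = eSym (m+1) g J + g a * eSym m g J := by
  have hn : ∀ S ∈ J.powersetCard m, a ∉ S := fun S hS h => ha ((mem_powersetCard.1 hS).1 h)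
  unfold eSym
  rw [powersetCard_succ_insert ha, sum_union, sum_image, mul_sum]
  · congr 1
    exact sum_congr rfl fun S hS => prod_insert (hn S hS)
  · intro S hS T hT h
    rw [← erase_insert (hn S hS), ← erase_insert (hn T hT)]
    exact congrArg (fun U => U.erase a) h
  · rw [disjoint_left]
    intro S hS hS'
    obtain ⟨T, -, rfl⟩ := mem_image.1 hS'
    exact ha ((mem_powersetCard.1 hS).1 (mem_insert_self _ _))

theorem newton3 {n : ℕ} {R : Type*} [CommRing R] (g : Fin n → R) (J : Finset (Fin n)) :
    eSym 0 g J = 1 ∧ eSym 1 g J = ∑ i ∈ J, g i ∧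
    2 * eSym 2 g J = (∑ i ∈ J, g i) ^ 2 - ∑ i ∈ J, g i ^ 2 ∧
    3 * eSym 3 g J = eSym 2 g J * (∑ i ∈ J, g i) - (∑ i ∈ J, g i) * (∑ i ∈ J, g i ^ 2)
      + ∑ i ∈ J, g i ^ 3 := by
  induction J using Finset.induction_on with
  | empty =>
    have h : ∀ m, eSym (m+1) g ∅ = 0 := fun m => by
      rw [eSym, powersetCard_eq_empty.2 (by simp), sum_empty]
    rw [h 0, h 1, h 2]
    simp [eSym]
  | insert a J ha ih =>
    obtain ⟨h0, h1, h2, h3⟩ := ih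
    have e0 : eSym 0 g (insert a J) = 1 := by simp [eSym]
    rw [eSym_insert 0 g J a ha, eSym_insert 1 g J a ha, eSym_insert 2 g J a ha]
    simp only [sum_insert ha]
    refine ⟨e0, ?_, ?_, ?_⟩
    · rw [h0, h1]; ring
    · rw [h1]; linear_combination h2
    · rw [h1]; linear_combination h3 + g a * h2

theorem stmt_18 (k : ℕ) (hk : 1 ≤ k) (hk3 : Nat.gcd k 3 = 1)
    (g : Fin (4 * k - 3) → ZMod k) :
    ∃ J : Finset (Fin (4 * k - 3)), J.card = k ∧ eSym 3 g J = 0 := by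
  have : NeZero k := ⟨by omega⟩
  obtain ⟨J, -, hJ, h1, h3⟩ := kemnitz_int k (univ : Finset (Fin (4 * k - 3)))
    (fun i => ((g i).val : ℤ)) (fun i => ((g i).val : ℤ) ^ 3) (by simp)
  refine ⟨J, hJ, ?_⟩
  rw [← ZMod.intCast_zmod_eq_zero_iff_dvd] at h1 h3
  push_cast at h1 h3
  simp only [ZMod.natCast_val, ZMod.cast_id', id] at h1 h3
  have hN := (newton3 g J).2.2.2
  rw [h1, h3] at hN
  have hu : IsUnit ((3 : ℕ) : ZMod k) := (ZMod.isUnit_iff_coprime 3 k).2 (Nat.Coprime.symm hk3)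
  push_cast at hu
  exact hu.mul_right_eq_zero.1 (by rw [hN]; ring)
end
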